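/- arXiv:2305.10007 — 2 statements merged into one kernel-verified Lean document; each statement's English description precedes it below -/
import Mathlib

section
/- Let n ≥ 3, R > 0, δ < 0 and ε > 0, and let ω = (ω₁, …, ω_n) : {x ∈ ℝⁿ : |x| > R} → ℝⁿ be a smooth vector field with each component ω_i harmonic, with ω = 𝒪_∞(r^δ), and with div ω := ∑_{i=1}^n ∂ω_i/∂x_i = 𝒪_∞(r^{1−n−ε}). Then ω = 𝒪_∞(r^{1−n}). -/
/-- The Laplacian `Δf = ∑ i, ∂²f/∂xᵢ²` of a map `f : ℝⁿ → E`, computed via iterated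
Fréchet derivatives in the coordinate directions. -/
noncomputable def vecLaplacian {n : ℕ} {E : Type*} [NormedAddCommGroup E] [NormedSpace ℝ E]
    (f : EuclideanSpace ℝ (Fin n) → E) (x : EuclideanSpace ℝ (Fin n)) : E :=
  ∑ i : Fin n,
    fderiv ℝ (fun y => fderiv ℝ f y (EuclideanSpace.single i 1)) x (EuclideanSpace.single i 1)

/-- `f` is harmonic on the open set `U`: it is smooth on `U` and `Δf = 0` on `U`. -/
def IsHarmonicOn {n : ℕ} {E : Type*} [NormedAddCommGroup E] [NormedSpace ℝ E]
    (f : EuclideanSpace ℝ (Fin n) → E) (U : Set (EuclideanSpace ℝ (Fin n))) : Prop :=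
  ContDiffOn ℝ (⊤ : ℕ∞) f U ∧ ∀ x ∈ U, vecLaplacian f x = 0

/-- `f = 𝒪_∞(r^α)` on `{|x| > R}`: for every `j ∈ ℕ` there are `C > 0` and `R₀ ≥ R` such
that the `j`-th total derivative satisfies `‖D^j f(x)‖ ≤ C |x|^{α−j}` for all `|x| ≥ R₀`. -/
def BigOInfty {n : ℕ} {E : Type*} [NormedAddCommGroup E] [NormedSpace ℝ E]
    (f : EuclideanSpace ℝ (Fin n) → E) (R α : ℝ) : Prop :=
  ∀ j : ℕ, ∃ C > 0, ∃ R₀ ≥ R, ∀ x : EuclideanSpace ℝ (Fin n), R₀ ≤ ‖x‖ →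
    ‖iteratedFDeriv ℝ j f x‖ ≤ C * ‖x‖ ^ (α - (j : ℝ))

/-- The divergence `div ω = ∑ i, ∂ωᵢ/∂xᵢ` of a vector field `ω` on `ℝⁿ`. -/
noncomputable def divergence {n : ℕ}
    (ω : EuclideanSpace ℝ (Fin n) → EuclideanSpace ℝ (Fin n))
    (x : EuclideanSpace ℝ (Fin n)) : ℝ :=
  ∑ i : Fin n, fderiv ℝ (fun y => ω y i) x (EuclideanSpace.single i 1)

section

open MeasureTheory Filter Topology
open scoped ContDiff

section ParametricConvolution

theorem integral_linearIsometryEquiv_comp {X A B : Type*} [MeasurableSpace X]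
    [NormedAddCommGroup A] [NormedSpace ℝ A] [NormedAddCommGroup B] [NormedSpace ℝ B]
    (μ : Measure X) (L : A ≃ₗᵢ[ℝ] B) (φ : X → A) : ∫ y, L (φ y) ∂μ = L (∫ y, φ y ∂μ) :=
  L.toContinuousLinearEquiv.integral_comp_comm φ

theorem continuous_smul_comp_sub {E V : Type*} [NormedAddCommGroup E]
    [NormedAddCommGroup V] [NormedSpace ℝ V] {f : E → ℝ} {a : ℝ} (hf : Continuous f)
    (hfa : ∀ y, a < ‖y‖ → f y = 0) {K : E → V} (hK : ∀ z ≠ 0, ContinuousAt K z) {x : E}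
    (hx : a < ‖x‖) : Continuous fun y => f y • K (x - y) := by
  rw [continuous_iff_continuousAt]
  intro y
  by_cases hy : y = x
  · have : (fun y => f y • K (x - y)) =ᶠ[𝓝 y] fun _ => 0 := by
      have : ∀ᶠ z in 𝓝 y, a < ‖z‖ :=
        continuous_norm.continuousAt.eventually (lt_mem_nhds (by simpa [hy] using hx))
      filter_upwards [this] with z hz
      simp [hfa z hz]
    exact continuousAt_const.congr this.symm
  · refine hf.continuousAt.smul ?_
    exact ContinuousAt.comp (f := fun y => x - y) (hK _ (sub_ne_zero.2 (Ne.symm hy)))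
      (by fun_prop)

variable {E V : Type*} [NormedAddCommGroup E] [NormedSpace ℝ E] [FiniteDimensional ℝ E]
  [MeasurableSpace E] [BorelSpace E] [NormedAddCommGroup V] [NormedSpace ℝ V]

theorem integrable_smul_comp_sub (μ : Measure E) [IsFiniteMeasureOnCompacts μ]
    {f : E → ℝ} {a : ℝ} (hf : Continuous f)
    (hfa : ∀ y, a < ‖y‖ → f y = 0) {K : E → V} (hK : ∀ z ≠ 0, ContinuousAt K z) {x : E}
    (hx : a < ‖x‖) : Integrable (fun y => f y • K (x - y)) μ := by
  refine (continuous_smul_comp_sub hf hfa hK hx).integrable_of_hasCompactSupport ?_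
  refine HasCompactSupport.intro (isCompact_closedBall 0 a) fun y hy => ?_
  rw [hfa y (by simpa using hy), zero_smul]

theorem hasFDerivAt_integral_smul_comp_sub (μ : Measure E) [IsFiniteMeasureOnCompacts μ]
    {f : E → ℝ} {a : ℝ} (hf : Continuous f)
    (hfa : ∀ y, a < ‖y‖ → f y = 0) {K : E → V} (hK : ∀ z ≠ 0, ContDiffAt ℝ 1 K z) {x : E}
    (hx : a < ‖x‖) :
    HasFDerivAt (fun x => ∫ y, f y • K (x - y) ∂μ) (∫ y, f y • fderiv ℝ K (x - y) ∂μ) x := by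
  set d := (‖x‖ - a) / 2 with hd
  have hd0 : 0 < d := by linarith
  have hK0 : ∀ z ≠ 0, ContinuousAt K z := fun z hz => (hK z hz).continuousAt
  have hK1 : ∀ z ≠ 0, ContinuousAt (fderiv ℝ K) z := fun z hz =>
    ((hK z hz).fderiv_right (m := 0) (by simp)).continuousAt
  obtain ⟨B, hB⟩ : ∃ B, ∀ z ∈ Metric.closedBall (0 : E) (‖x‖ + d + a) \ Metric.ball 0 d,
      ‖fderiv ℝ K z‖ ≤ B := by
    refine ((isCompact_closedBall _ _).diff Metric.isOpen_ball).exists_bound_of_continuousOn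
      fun z hz => (hK1 z ?_).continuousWithinAt
    rintro rfl
    exact hz.2 (by simpa using hd0)
  have hnear : ∀ x' ∈ Metric.ball x d, a + d < ‖x'‖ ∧ ‖x'‖ ≤ ‖x‖ + d := by
    intro x' hx'
    rw [mem_ball_iff_norm] at hx'
    have h1 := norm_sub_norm_le x x'
    have h2 := norm_sub_norm_le x' x
    rw [norm_sub_rev] at h1
    constructor <;> linarith
  refine hasFDerivAt_integral_of_dominated_of_fderiv_le (s := Metric.ball x d)
    (bound := fun y => |f y| * B) (F' := fun x y => f y • fderiv ℝ K (x - y))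
    (Metric.ball_mem_nhds x hd0) ?_ ?_ ?_ ?_ ?_ ?_
  · filter_upwards [Metric.ball_mem_nhds x hd0] with x' hx'
    exact (continuous_smul_comp_sub hf hfa hK0 (by linarith [(hnear x' hx').1])).aestronglyMeasurable
  · exact integrable_smul_comp_sub μ hf hfa hK0 hx
  · exact (continuous_smul_comp_sub hf hfa hK1 hx).aestronglyMeasurable
  · refine Eventually.of_forall fun y x' hx' => ?_
    by_cases hy : a < ‖y‖
    · simp [hfa y hy]
    · rw [norm_smul, Real.norm_eq_abs]
      refine mul_le_mul_of_nonneg_left (hB _ ?_) (abs_nonneg _)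
      have := hnear x' hx'
      have h1 := norm_sub_norm_le x' y
      have h2 := norm_sub_le x' y
      simp only [Set.mem_sdiff, mem_closedBall_zero_iff, mem_ball_zero_iff]
      constructor <;> linarith
  · refine Continuous.integrable_of_hasCompactSupport (by fun_prop) ?_
    refine HasCompactSupport.intro (isCompact_closedBall 0 a) fun y hy => ?_
    rw [hfa y (by simpa using hy), abs_zero, zero_mul]
  · refine Eventually.of_forall fun y x' hx' => ?_
    by_cases hy : a < ‖y‖
    · simpa [hfa y hy] using hasFDerivAt_const (0 : V) x'
    · have hne : x' - y ≠ 0 := by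
        intro h
        rw [sub_eq_zero.1 h] at hx'
        linarith [(hnear y hx').1]
      have := ((hK _ hne).differentiableAt one_ne_zero).hasFDerivAt.comp x'
        ((hasFDerivAt_id x').sub_const y)
      exact this.const_smul (f y)

theorem iteratedFDeriv_integral_smul_comp_sub (μ : Measure E) [IsFiniteMeasureOnCompacts μ]
    {f : E → ℝ} {a : ℝ} (hf : Continuous f)
    (hfa : ∀ y, a < ‖y‖ → f y = 0) {K : E → V} (hK : ∀ z ≠ 0, ContDiffAt ℝ ∞ K z) (j : ℕ) {x : E}
    (hx : a < ‖x‖) :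
    iteratedFDeriv ℝ j (fun x => ∫ y, f y • K (x - y) ∂μ) x =
      ∫ y, f y • iteratedFDeriv ℝ j K (x - y) ∂μ := by
  induction j generalizing x with
  | zero =>
    simp only [iteratedFDeriv_zero_eq_comp, Function.comp_def]
    exact (integral_linearIsometryEquiv_comp (A := V) (B := ContinuousMultilinearMap ℝ
      (fun _ : Fin 0 => E) V) μ (continuousMultilinearCurryFin0 ℝ E V).symm _).symm.trans (by simp)
  | succ j ih =>
    have hev : iteratedFDeriv ℝ j (fun x => ∫ y, f y • K (x - y) ∂μ) =ᶠ[𝓝 x]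
        fun x => ∫ y, f y • iteratedFDeriv ℝ j K (x - y) ∂μ := by
      filter_upwards [continuous_norm.continuousAt.eventually (lt_mem_nhds hx)] with z hz
      exact ih hz
    have hKj : ∀ z ≠ 0, ContDiffAt ℝ 1 (iteratedFDeriv ℝ j K) z := fun z hz =>
      (hK z hz).iteratedFDeriv_right (by exact_mod_cast le_top)
    rw [iteratedFDeriv_succ_eq_comp_left, Function.comp_apply, hev.fderiv_eq,
      (hasFDerivAt_integral_smul_comp_sub μ hf hfa hKj hx).fderiv]
    refine Eq.trans (integral_linearIsometryEquiv_comp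
      (A := E →L[ℝ] ContinuousMultilinearMap ℝ (fun _ : Fin j => E) V)
      (B := ContinuousMultilinearMap ℝ (fun _ : Fin (j + 1) => E) V) μ
      (continuousMultilinearCurryLeftEquiv ℝ (fun _ : Fin (j + 1) => E) V).symm
      fun y => f y • fderiv ℝ (iteratedFDeriv ℝ j K) (x - y)).symm ?_
    simp only [map_smul, iteratedFDeriv_succ_eq_comp_left, Function.comp_apply]

theorem contDiffAt_integral_smul_comp_sub (μ : Measure E) [IsFiniteMeasureOnCompacts μ]
    {f : E → ℝ} {a : ℝ} (hf : Continuous f)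
    (hfa : ∀ y, a < ‖y‖ → f y = 0) {K : E → V} (hK : ∀ z ≠ 0, ContDiffAt ℝ ∞ K z) {x : E}
    (hx : a < ‖x‖) :
    ContDiffAt ℝ ∞ (fun x => ∫ y, f y • K (x - y) ∂μ) x := by
  have hopen : IsOpen {x : E | a < ‖x‖} := isOpen_lt continuous_const continuous_norm
  refine ContDiffOn.contDiffAt (s := {x | a < ‖x‖}) ?_ (hopen.mem_nhds hx)
  refine contDiffOn_of_differentiableOn fun j _ => ?_
  have hKj : ∀ z ≠ 0, ContDiffAt ℝ 1 (iteratedFDeriv ℝ j K) z := fun z hz =>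
    (hK z hz).iteratedFDeriv_right (by exact_mod_cast le_top)
  refine DifferentiableOn.congr (f := fun x => ∫ y, f y • iteratedFDeriv ℝ j K (x - y) ∂μ)
    (fun z hz => (hasFDerivAt_integral_smul_comp_sub μ hf hfa hKj
      hz).differentiableAt.differentiableWithinAt) fun z hz => ?_
  rw [iteratedFDerivWithin_of_isOpen j hopen hz,
    iteratedFDeriv_integral_smul_comp_sub μ hf hfa hK j hz]

end ParametricConvolution

section NormPower

variable {E : Type*} [NormedAddCommGroup E] [InnerProductSpace ℝ E]

theorem contDiffAt_norm_rpow (p : ℝ) {z : E} (hz : z ≠ 0) :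
    ContDiffAt ℝ ∞ (fun z : E => ‖z‖ ^ p) z :=
  (contDiffAt_id.norm ℝ hz).rpow_const_of_ne (norm_ne_zero_iff.2 hz)

theorem norm_iteratedFDeriv_comp_smul {V : Type*} [NormedAddCommGroup V] [NormedSpace ℝ V]
    (g : E → V) {t : ℝ} (ht : 0 < t) (j : ℕ) (z : E) :
    ‖iteratedFDeriv ℝ j (fun z => g (t • z)) z‖ = t ^ j * ‖iteratedFDeriv ℝ j g (t • z)‖ := by
  have h := (ContinuousLinearEquiv.smulLeft (R₁ := ℝ) (M₁ := E)
    (Units.mk0 t ht.ne')).iteratedFDerivWithin_comp_right g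
    (uniqueDiffOn_univ) (x := z) (Set.mem_univ _) j
  simp only [Set.preimage_univ, iteratedFDerivWithin_univ] at h
  have h2 : (iteratedFDeriv ℝ j (fun z => g (t • z)) z) =
      t ^ j • iteratedFDeriv ℝ j g (t • z) := by
    refine Eq.trans h ?_
    ext m
    have := (iteratedFDeriv ℝ j g (t • z)).map_smul_univ (fun _ => t) m
    simpa using this
  rw [h2, norm_smul, norm_pow, Real.norm_of_nonneg ht.le]

theorem exists_norm_iteratedFDeriv_norm_rpow_le [FiniteDimensional ℝ E] (p : ℝ) (j : ℕ) :
    ∃ C > 0, ∀ z : E, z ≠ 0 →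
      ‖iteratedFDeriv ℝ j (fun z : E => ‖z‖ ^ p) z‖ ≤ C * ‖z‖ ^ (p - j) := by
  obtain ⟨C, hC⟩ : ∃ C, ∀ z ∈ Metric.sphere (0 : E) 1,
      ‖iteratedFDeriv ℝ j (fun z : E => ‖z‖ ^ p) z‖ ≤ C := by
    refine (isCompact_sphere _ _).exists_bound_of_continuousOn fun z hz => ?_
    have hz0 : z ≠ 0 := by
      rintro rfl
      simp at hz
    exact ((contDiffAt_norm_rpow p hz0).iteratedFDeriv_right (m := 0)
      (by exact_mod_cast le_top)).continuousAt.continuousWithinAt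
  refine ⟨|C| + 1, by positivity, fun z hz => ?_⟩
  have hn : 0 < ‖z‖ := norm_pos_iff.2 hz
  set w : E := ‖z‖⁻¹ • z with hw
  have hwn : ‖w‖ = 1 := by rw [hw, norm_smul, norm_inv, norm_norm, inv_mul_cancel₀ hn.ne']
  have hwz : ‖z‖ • w = z := by rw [hw, smul_inv_smul₀ hn.ne']
  have hw0 : w ≠ 0 := by rw [← norm_ne_zero_iff, hwn]; exact one_ne_zero
  have h1 := norm_iteratedFDeriv_comp_smul (fun z : E => ‖z‖ ^ p) hn j w
  have h2 : (fun y : E => ‖‖z‖ • y‖ ^ p) = (‖z‖ ^ p) • fun y : E => ‖y‖ ^ p := by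
    ext y
    rw [norm_smul, norm_norm, Real.mul_rpow hn.le (norm_nonneg _)]
    rfl
  rw [hwz, h2, iteratedFDeriv_const_smul_apply
    ((contDiffAt_norm_rpow p hw0).of_le (by exact_mod_cast le_top)), norm_smul,
    Real.norm_of_nonneg (by positivity)] at h1
  have h3 := hC w (by simpa using hwn)
  rw [Real.rpow_sub hn, Real.rpow_natCast, mul_div_assoc', le_div_iff₀ (by positivity), mul_comm,
    ← h1, mul_comm]
  gcongr
  linarith [le_abs_self C]

theorem exists_norm_iteratedFDeriv_norm_rpow_sub_le [FiniteDimensional ℝ E] {p : ℝ} (hp : p ≤ 0)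
    (j : ℕ) {b : ℝ} (hb : 0 < b) :
    ∃ C > 0, ∀ x y : E, ‖y‖ ≤ b → 2 * b ≤ ‖x‖ →
      ‖iteratedFDeriv ℝ j (fun z : E => ‖z‖ ^ p) (x - y) -
        iteratedFDeriv ℝ j (fun z : E => ‖z‖ ^ p) x‖ ≤ C * ‖x‖ ^ (p - 1 - j) := by
  obtain ⟨C, hC0, hC⟩ := exists_norm_iteratedFDeriv_norm_rpow_le (E := E) p (j + 1)
  refine ⟨C * (2⁻¹ : ℝ) ^ (p - 1 - j) * b, by positivity, fun x y hy hx => ?_⟩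
  have hx0 : 0 < ‖x‖ := by linarith
  have hs : ∀ z ∈ Metric.closedBall x b, ‖x‖ / 2 ≤ ‖z‖ ∧ z ≠ 0 := by
    intro z hz
    rw [mem_closedBall_iff_norm] at hz
    have h1 := norm_sub_norm_le x z
    rw [norm_sub_rev] at h1
    have h2 : ‖x‖ / 2 ≤ ‖z‖ := by linarith
    exact ⟨h2, norm_pos_iff.1 (by linarith)⟩
  have key := (convex_closedBall x b).norm_image_sub_le_of_norm_fderiv_le (𝕜 := ℝ)
    (f := iteratedFDeriv ℝ j (fun z : E => ‖z‖ ^ p)) (x := x) (y := x - y)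
    (C := C * (2⁻¹ : ℝ) ^ (p - 1 - j) * ‖x‖ ^ (p - 1 - j))
    (fun z hz => ((contDiffAt_norm_rpow p (hs z hz).2).iteratedFDeriv_right (m := 1)
      (by exact_mod_cast le_top)).differentiableAt one_ne_zero) (fun z hz => ?_)
    (Metric.mem_closedBall_self hb.le) (by simpa using hy)
  · refine key.trans ?_
    rw [sub_sub_cancel_left, norm_neg, mul_right_comm _ b]
    gcongr
  · rw [norm_fderiv_iteratedFDeriv]
    refine (hC z (hs z hz).2).trans ?_
    rw [mul_assoc, ← Real.mul_rpow (by norm_num) hx0.le]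
    have he : p - ((j + 1 : ℕ) : ℝ) = p - 1 - j := by push_cast; ring
    rw [he]
    refine mul_le_mul_of_nonneg_left (Real.rpow_le_rpow_of_nonpos (by positivity) ?_ ?_) hC0.le
    · linarith [(hs z hz).1]
    · have : (0 : ℝ) ≤ j := j.cast_nonneg
      linarith

end NormPower

section Laplacian

theorem HasCompactSupport.fderiv_apply_const {E F : Type*} [NormedAddCommGroup E]
    [NormedSpace ℝ E] [NormedAddCommGroup F] [NormedSpace ℝ F] {φ : E → F}
    (hφ : HasCompactSupport φ) (e : E) : HasCompactSupport fun y => fderiv ℝ φ y e :=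
  (hφ.fderiv ℝ).comp_left (g := fun L : E →L[ℝ] F => L e) rfl

theorem integral_fderiv_fderiv_mul_comm {E : Type*} [NormedAddCommGroup E] [NormedSpace ℝ E]
    [FiniteDimensional ℝ E] [MeasurableSpace E] [BorelSpace E] (μ : Measure E)
    [μ.IsAddHaarMeasure] {g φ : E → ℝ} (hg : ContDiff ℝ 2 g) (hφ : ContDiff ℝ 2 φ)
    (hc : HasCompactSupport φ) (e : E) :
    ∫ y, fderiv ℝ (fun y => fderiv ℝ g y e) y e * φ y ∂μ =
      ∫ y, g y * fderiv ℝ (fun y => fderiv ℝ φ y e) y e ∂μ := by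
  have hd : ∀ {h : E → ℝ}, ContDiff ℝ 2 h → ContDiff ℝ 1 fun y => fderiv ℝ h y e := fun h2 =>
    (h2.fderiv_right (m := 1) (by norm_num)).clm_apply contDiff_const
  have hdc : ∀ {h : E → ℝ}, ContDiff ℝ 1 h → Continuous fun y => fderiv ℝ h y e := fun h1 =>
    ((h1.fderiv_right (m := 0) (by norm_num)).clm_apply contDiff_const).continuous
  have hc1 := hc.fderiv_apply_const e
  have hc2 := hc1.fderiv_apply_const e
  have cg := hg.continuous
  have cφ := hφ.continuous
  have cg1 := (hd hg).continuous
  have cφ1 := (hd hφ).continuous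
  have cg2 := hdc (hd hg)
  have cφ2 := hdc (hd hφ)
  have h1 := integral_mul_fderiv_eq_neg_fderiv_mul_of_integrable (μ := μ) (v := e) (f := g)
    (g := fun y => fderiv ℝ φ y e)
    ((cg1.mul cφ1).integrable_of_hasCompactSupport hc1.mul_left)
    ((cg.mul cφ2).integrable_of_hasCompactSupport hc2.mul_left)
    ((cg.mul cφ1).integrable_of_hasCompactSupport hc1.mul_left)
    (fun y _ => (hg.differentiable two_ne_zero) y)
    (fun y _ => ((hd hφ).differentiable one_ne_zero) y)
  have h2 := integral_mul_fderiv_eq_neg_fderiv_mul_of_integrable (μ := μ) (v := e) (g := φ)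
    (f := fun y => fderiv ℝ g y e)
    ((cg2.mul cφ).integrable_of_hasCompactSupport hc.mul_left)
    ((cg1.mul cφ1).integrable_of_hasCompactSupport hc1.mul_left)
    ((cg1.mul cφ).integrable_of_hasCompactSupport hc.mul_left)
    (fun y _ => ((hd hg).differentiable one_ne_zero) y)
    (fun y _ => (hφ.differentiable two_ne_zero) y)
  rw [h1, h2, neg_neg]

variable {n : ℕ}

local notation "𝔼" => EuclideanSpace ℝ (Fin n)

theorem ContDiff.continuous_vecLaplacian {g : 𝔼 → ℝ} (hg : ContDiff ℝ 2 g) :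
    Continuous (vecLaplacian g) := by
  refine continuous_finsetSum _ fun i _ => ?_
  have h1 : ContDiff ℝ 1 fun y => fderiv ℝ g y (EuclideanSpace.single i 1) :=
    (hg.fderiv_right (m := 1) (by norm_num)).clm_apply contDiff_const
  exact ((h1.fderiv_right (m := 0) (by norm_num)).clm_apply contDiff_const).continuous

theorem integral_vecLaplacian_mul_comm {g φ : 𝔼 → ℝ} (hg : ContDiff ℝ 2 g)
    (hφ : ContDiff ℝ 2 φ) (hc : HasCompactSupport φ) :
    ∫ y, vecLaplacian g y * φ y = ∫ y, g y * vecLaplacian φ y := by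
  have hd : ∀ {h : 𝔼 → ℝ}, ContDiff ℝ 2 h → ∀ e, Continuous fun y =>
      fderiv ℝ (fun y => fderiv ℝ h y e) y e := fun h2 e =>
    ((((h2.fderiv_right (m := 1) (by norm_num)).clm_apply contDiff_const).fderiv_right
      (m := 0) (by norm_num)).clm_apply contDiff_const).continuous
  simp only [vecLaplacian, Finset.sum_mul, Finset.mul_sum]
  rw [integral_finsetSum, integral_finsetSum]
  · exact Finset.sum_congr rfl fun i _ => integral_fderiv_fderiv_mul_comm _ hg hφ hc _
  · exact fun i _ => (hg.continuous.mul (hd hφ _)).integrable_of_hasCompactSupport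
      ((hc.fderiv_apply_const _).fderiv_apply_const _).mul_left
  · exact fun i _ => ((hd hg _).mul hφ.continuous).integrable_of_hasCompactSupport hc.mul_left

theorem abs_vecLaplacian_le {g : 𝔼 → ℝ} {x : 𝔼} (hg : ContDiffAt ℝ 2 g x) :
    |vecLaplacian g x| ≤ n * ‖iteratedFDeriv ℝ 2 g x‖ := by
  have hd : DifferentiableAt ℝ (fderiv ℝ g) x :=
    (hg.fderiv_right (m := 1) (by norm_num)).differentiableAt one_ne_zero
  have hterm : ∀ i : Fin n, |fderiv ℝ (fun y => fderiv ℝ g y (EuclideanSpace.single i 1)) x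
      (EuclideanSpace.single i 1)| ≤ ‖iteratedFDeriv ℝ 2 g x‖ := by
    intro i
    have h := (iteratedFDeriv ℝ 2 g x).le_opNorm fun _ => EuclideanSpace.single i (1 : ℝ)
    rw [iteratedFDeriv_two_apply] at h
    rw [fderiv_clm_apply hd (differentiableAt_const _)]
    simpa using h
  calc |vecLaplacian g x| ≤ ∑ i : Fin n, |fderiv ℝ (fun y => fderiv ℝ g y
        (EuclideanSpace.single i 1)) x (EuclideanSpace.single i 1)| :=
        Finset.abs_sum_le_sum_abs _ _
    _ ≤ ∑ _i : Fin n, ‖iteratedFDeriv ℝ 2 g x‖ := Finset.sum_le_sum fun i _ => hterm i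
    _ = n * ‖iteratedFDeriv ℝ 2 g x‖ := by simp

theorem Filter.EventuallyEq.vecLaplacian_eq {f g : 𝔼 → ℝ} {x : 𝔼} (h : f =ᶠ[𝓝 x] g) :
    vecLaplacian f x = vecLaplacian g x := by
  refine Finset.sum_congr rfl fun i _ => ?_
  have : (fun y => fderiv ℝ f y (EuclideanSpace.single i 1)) =ᶠ[𝓝 x]
      fun y => fderiv ℝ g y (EuclideanSpace.single i 1) := by
    filter_upwards [h.fderiv (𝕜 := ℝ)] with y hy
    rw [hy]
  rw [this.fderiv_eq]

theorem contDiff_regularized_rpow (m : ℝ) {s : ℝ} (hs : 0 < s) (x : 𝔼) :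
    ContDiff ℝ ∞ fun y : 𝔼 => (‖y - x‖ ^ 2 + s) ^ m := by
  refine ContDiff.rpow_const_of_ne ?_ fun y => by positivity
  exact ((contDiff_id.sub contDiff_const).norm_sq ℝ).add contDiff_const

theorem hasFDerivAt_regularized_rpow (m : ℝ) {s : ℝ} (hs : 0 < s) (x y : 𝔼) :
    HasFDerivAt (fun y : 𝔼 => (‖y - x‖ ^ 2 + s) ^ m)
      ((m * (‖y - x‖ ^ 2 + s) ^ (m - 1)) • (2 • innerSL ℝ (y - x))) y := by
  have h := (((hasFDerivAt_id y).sub_const x).norm_sq.add_const s).rpow_const (p := m)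
    (Or.inl (ne_of_gt (by positivity)))
  exact h

theorem vecLaplacian_regularized_rpow {s : ℝ} (hs : 0 < s) (x y : 𝔼) :
    vecLaplacian (fun y : 𝔼 => (‖y - x‖ ^ 2 + s) ^ ((2 - n : ℝ) / 2)) y =
      -(n * (n - 2) * s) * (‖y - x‖ ^ 2 + s) ^ (-(n + 2 : ℝ) / 2) := by
  set m : ℝ := (2 - n : ℝ) / 2 with hm
  have hp : 0 < ‖y - x‖ ^ 2 + s := by positivity
  have hterm : ∀ i : Fin n, fderiv ℝ (fun z => fderiv ℝ
      (fun y : 𝔼 => (‖y - x‖ ^ 2 + s) ^ m) z (EuclideanSpace.single i 1)) y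
        (EuclideanSpace.single i 1) =
      4 * m * (m - 1) * (‖y - x‖ ^ 2 + s) ^ (m - 1 - 1) * ((y - x) i) ^ 2 +
        2 * m * (‖y - x‖ ^ 2 + s) ^ (m - 1) := by
    intro i
    have h1 : (fun z => fderiv ℝ (fun y : 𝔼 => (‖y - x‖ ^ 2 + s) ^ m) z
        (EuclideanSpace.single i 1)) =
        fun z => 2 * m * (‖z - x‖ ^ 2 + s) ^ (m - 1) * (z - x) i := by
      ext z
      rw [(hasFDerivAt_regularized_rpow m hs x z).fderiv]
      simp [EuclideanSpace.inner_single_right]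
      ring
    rw [h1]
    have h2 : HasFDerivAt (fun z : 𝔼 => (z - x) i) (EuclideanSpace.proj (𝕜 := ℝ) i) y :=
      (EuclideanSpace.proj (𝕜 := ℝ) i : 𝔼 →L[ℝ] ℝ).hasFDerivAt.comp y
        ((hasFDerivAt_id y).sub_const x)
    have h3 := (((hasFDerivAt_regularized_rpow (m - 1) hs x y).const_mul (2 * m)).mul h2).fderiv
    rw [Pi.mul_def] at h3
    rw [h3]
    simp [EuclideanSpace.inner_single_right]
    ring
  rw [vecLaplacian, Finset.sum_congr rfl fun i _ => hterm i, Finset.sum_add_distrib,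
    ← Finset.mul_sum, ← EuclideanSpace.real_norm_sq_eq]
  simp only [Finset.sum_const, Finset.card_univ, Fintype.card_fin, nsmul_eq_mul]
  have e1 : (‖y - x‖ ^ 2 + s) ^ (m - 1) =
      (‖y - x‖ ^ 2 + s) ^ (m - 1 - 1) * (‖y - x‖ ^ 2 + s) := by
    rw [← Real.rpow_add_one hp.ne']; congr 1; ring
  have e2 : -(n + 2 : ℝ) / 2 = m - 1 - 1 := by rw [hm]; ring
  rw [e1, e2, hm]
  ring

end Laplacian

section NewtonianRepresentation

variable {n : ℕ}

local notation "𝔼" => EuclideanSpace ℝ (Fin n)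

theorem integral_regularized_rescale (φ : 𝔼 → ℝ) (x : 𝔼) {t : ℝ} (ht : 0 < t) :
    ∫ y, t ^ 2 * (‖y - x‖ ^ 2 + t ^ 2) ^ (-(n + 2 : ℝ) / 2) * φ y =
      ∫ z, (1 + ‖z‖ ^ 2) ^ (-(n + 2 : ℝ) / 2) * φ (x + t • z) := by
  rw [← integral_add_left_eq_self _ x]
  have h := Measure.integral_comp_smul (volume : Measure 𝔼)
    (fun y => t ^ 2 * (‖x + y - x‖ ^ 2 + t ^ 2) ^ (-(n + 2 : ℝ) / 2) * φ (x + y)) t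
  rw [finrank_euclideanSpace_fin, abs_of_pos (by positivity), smul_eq_mul,
    eq_inv_mul_iff_mul_eq₀ (by positivity)] at h
  rw [← h, ← integral_const_mul]
  congr 1
  ext z
  have h1 : ‖x + t • z - x‖ ^ 2 + t ^ 2 = t ^ 2 * (1 + ‖z‖ ^ 2) := by
    rw [add_sub_cancel_left, norm_smul, Real.norm_of_nonneg ht.le]
    ring
  have h2 : (t ^ 2) ^ (-(n + 2 : ℝ) / 2) = (t ^ (n + 2))⁻¹ := by
    rw [← Real.rpow_natCast, ← Real.rpow_mul ht.le, ← Real.rpow_natCast, ← Real.rpow_neg ht.le]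
    congr 1
    push_cast
    ring
  rw [h1, Real.mul_rpow (by positivity) (by positivity), h2, pow_add]
  field_simp

theorem tendsto_integral_rescaled_mul {φ : ℕ → 𝔼 → ℝ} {v : 𝔼 → ℝ} {M : ℝ}
    (hφ : ∀ k, Continuous (φ k)) (hM : ∀ k y, |φ k y| ≤ M) (hv : Continuous v)
    (heq : ∀ (k : ℕ) y, ‖y‖ < k → φ k y = v y) (x : 𝔼) :
    Tendsto (fun k : ℕ => ∫ z : 𝔼, (1 + ‖z‖ ^ 2) ^ (-(n + 2 : ℝ) / 2) * φ k (x + (k : ℝ)⁻¹ • z))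
      atTop (𝓝 ((∫ z : 𝔼, (1 + ‖z‖ ^ 2) ^ (-(n + 2 : ℝ) / 2)) * v x)) := by
  have hint : Integrable fun z : 𝔼 => (1 + ‖z‖ ^ 2) ^ (-(n + 2 : ℝ) / 2) :=
    integrable_rpow_neg_one_add_norm_sq (by rw [finrank_euclideanSpace_fin]; linarith)
  have hcont : Continuous fun z : 𝔼 => (1 + ‖z‖ ^ 2) ^ (-(n + 2 : ℝ) / 2) :=
    Continuous.rpow_const (by fun_prop) fun z => Or.inl (ne_of_gt (by positivity))
  rw [← integral_mul_const]
  refine tendsto_integral_of_dominated_convergence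
    (fun z => (1 + ‖z‖ ^ 2) ^ (-(n + 2 : ℝ) / 2) * M) (fun k => ?_) (hint.mul_const M)
    (fun k => Eventually.of_forall fun z => ?_) (Eventually.of_forall fun z => ?_)
  · exact (hcont.mul ((hφ k).comp (by fun_prop))).aestronglyMeasurable
  · rw [norm_mul, Real.norm_of_nonneg (by positivity)]
    exact mul_le_mul_of_nonneg_left (hM _ _) (by positivity)
  · refine Tendsto.const_mul _ ?_
    have hlim : Tendsto (fun k : ℕ => x + (k : ℝ)⁻¹ • z) atTop (𝓝 x) := by
      have := (tendsto_inv_atTop_nhds_zero_nat (𝕜 := ℝ)).smul_const z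
      simpa using this.const_add x
    refine ((hv.tendsto x).comp hlim).congr' ?_
    have h1 := hlim.norm.eventually (gt_mem_nhds (lt_add_one ‖x‖))
    filter_upwards [h1, (tendsto_natCast_atTop_atTop (R := ℝ)).eventually_ge_atTop (‖x‖ + 1)] with k hk hk2
    exact (heq k _ (lt_of_lt_of_le hk hk2)).symm

theorem regularized_rpow_le {m s : ℝ} (hm : m ≤ 0) (hs : 0 ≤ s) {r d : ℝ} (hd : 0 < d)
    (hr : d ≤ r) : (r ^ 2 + s) ^ m ≤ (d ^ 2) ^ m :=
  Real.rpow_le_rpow_of_nonpos (by positivity) (by nlinarith) hm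

theorem tendsto_integral_regularized_mul {f : 𝔼 → ℝ} {b m : ℝ} (hm : m ≤ 0) (hf : Continuous f)
    (hfb : ∀ y, b < ‖y‖ → f y = 0) {x : 𝔼} (hx : b < ‖x‖) :
    Tendsto (fun k : ℕ => ∫ y, (‖y - x‖ ^ 2 + (k : ℝ)⁻¹ ^ 2) ^ m * f y)
      atTop (𝓝 (∫ y, f y * ‖x - y‖ ^ (2 * m))) := by
  have hfs : HasCompactSupport f :=
    HasCompactSupport.intro (isCompact_closedBall 0 b) fun y hy => hfb y (by simpa using hy)
  set d := ‖x‖ - b with hd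
  have hd0 : 0 < d := by linarith
  refine tendsto_integral_filter_of_dominated_convergence
    (fun y => (d ^ 2) ^ m * |f y|) ?_ ?_ ?_ ?_
  · filter_upwards [eventually_ge_atTop 1] with k hk
    have hk0 : (0 : ℝ) < k := by exact_mod_cast hk
    exact ((contDiff_regularized_rpow m (by positivity) x).continuous.mul hf).aestronglyMeasurable
  · refine Eventually.of_forall fun k => Eventually.of_forall fun y => ?_
    by_cases hy : b < ‖y‖
    · simp [hfb y hy]
    · rw [norm_mul, Real.norm_of_nonneg (by positivity), Real.norm_eq_abs]
      refine mul_le_mul_of_nonneg_right (regularized_rpow_le hm (by positivity) hd0 ?_)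
        (abs_nonneg _)
      have := norm_sub_norm_le x y
      rw [norm_sub_rev]
      linarith
  · exact (hf.abs.integrable_of_hasCompactSupport (hfs.comp_left abs_zero)).const_mul _
  · refine Eventually.of_forall fun y => ?_
    by_cases hy : b < ‖y‖
    · simp [hfb y hy]
    · have h0 : 0 < ‖y - x‖ := by
        rw [norm_pos_iff, sub_ne_zero]
        rintro rfl
        exact hy hx
      rw [mul_comm]
      refine Tendsto.mul_const _ ?_
      have h1 : Tendsto (fun k : ℕ => ‖y - x‖ ^ 2 + (k : ℝ)⁻¹ ^ 2) atTop (𝓝 (‖y - x‖ ^ 2)) := by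
        simpa using ((tendsto_inv_atTop_nhds_zero_nat (𝕜 := ℝ)).pow 2).const_add (‖y - x‖ ^ 2)
      have h2 := h1.rpow_const (p := m) (Or.inl (by positivity))
      have h3 : (‖y - x‖ ^ 2) ^ m = ‖x - y‖ ^ (2 * m) := by
        rw [← Real.rpow_natCast, ← Real.rpow_mul h0.le, norm_sub_rev y x, Nat.cast_two]
      rwa [h3] at h2

theorem exists_cutoff_laplacian_bound {v : 𝔼 → ℝ} (hv : ContDiff ℝ ∞ v) {b δ : ℝ} (hb : 0 < b)
    (hδ : δ < 0)
    (hlap : ∀ y, b < ‖y‖ → vecLaplacian v y = 0)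
    (hdecay : ∀ j : ℕ, ∃ C > 0, ∀ y, b ≤ ‖y‖ → ‖iteratedFDeriv ℝ j v y‖ ≤ C * ‖y‖ ^ (δ - j))
    (η : ContDiffBump (0 : 𝔼)) (hin : η.rIn = 1) (hout : η.rOut = 2) :
    ∃ C > 0, ∀ k : ℝ, b < k → ∀ y,
      |vecLaplacian (fun y => η (k⁻¹ • y) * v y) y - vecLaplacian v y| ≤
        C * k ^ (δ - 2) ∧
      (¬ (k ≤ ‖y‖ ∧ ‖y‖ ≤ 2 * k) →
        vecLaplacian (fun y => η (k⁻¹ • y) * v y) y - vecLaplacian v y = 0) := by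
  choose C hC0 hC using hdecay
  have hη : ContDiff ℝ ∞ η := η.contDiff
  have hM : ∀ i : ℕ, ∃ M, ∀ y, ‖iteratedFDeriv ℝ i η y‖ ≤ M := fun i =>
    (η.hasCompactSupport.iteratedFDeriv i).exists_bound_of_continuous
      (hη.continuous_iteratedFDeriv (by exact_mod_cast le_top))
  choose M hM using hM
  have hM0 : ∀ i, 0 ≤ M i := fun i => (norm_nonneg _).trans (hM i 0)
  have hS0 : 0 ≤ ∑ i ∈ Finset.range (2 + 1), (Nat.choose 2 i : ℝ) * M i * C (2 - i) :=
    Finset.sum_nonneg fun i _ =>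
      mul_nonneg (mul_nonneg (Nat.cast_nonneg _) (hM0 i)) (hC0 _).le
  refine ⟨n * (∑ i ∈ Finset.range (2 + 1), (Nat.choose 2 i : ℝ) * M i * C (2 - i)) + 1,
    by positivity, fun k hk y => ?_⟩
  have hk0 : 0 < k := hb.trans hk
  have hscale : ∀ y : 𝔼, ‖k⁻¹ • y‖ = ‖y‖ / k := fun y => by
    rw [norm_smul, Real.norm_of_nonneg (by positivity)]
    field_simp
  have hzero : ¬ (k ≤ ‖y‖ ∧ ‖y‖ ≤ 2 * k) →
      vecLaplacian (fun y => η (k⁻¹ • y) * v y) y - vecLaplacian v y = 0 := by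
    intro hy
    by_cases h1 : ‖y‖ < k
    · have : (fun y => η (k⁻¹ • y) * v y) =ᶠ[𝓝 y] v := by
        filter_upwards [continuous_norm.continuousAt.eventually (gt_mem_nhds h1)] with z hz
        rw [η.one_of_mem_closedBall, one_mul]
        rw [mem_closedBall_zero_iff, hin, hscale]
        exact (div_le_one hk0).2 hz.le
      rw [this.vecLaplacian_eq, sub_self]
    · have h2 : 2 * k < ‖y‖ := by
        by_contra h
        exact hy ⟨not_lt.1 h1, not_lt.1 h⟩
      have : (fun y => η (k⁻¹ • y) * v y) =ᶠ[𝓝 y] fun _ => 0 := by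
        filter_upwards [continuous_norm.continuousAt.eventually (lt_mem_nhds h2)] with z hz
        rw [η.zero_of_le_dist, zero_mul]
        rw [dist_zero_right, hout, hscale, le_div_iff₀ hk0]
        exact hz.le
      rw [this.vecLaplacian_eq, hlap y (by linarith)]
      simp [vecLaplacian]
  refine ⟨?_, hzero⟩
  by_cases hy : k ≤ ‖y‖ ∧ ‖y‖ ≤ 2 * k
  swap
  · rw [hzero hy, abs_zero]
    positivity
  rw [hlap y (by linarith [hy.1]), sub_zero]
  have hηk : ContDiff ℝ ∞ fun y : 𝔼 => η (k⁻¹ • y) := hη.comp (by fun_prop)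
  refine (abs_vecLaplacian_le
    ((hηk.mul hv).contDiffAt.of_le (WithTop.coe_le_coe.2 le_top))).trans ?_
  have hL := norm_iteratedFDeriv_mul_le hηk hv y (n := 2) (WithTop.coe_le_coe.2 le_top)
  have hsum : ‖iteratedFDeriv ℝ 2 (fun y => η (k⁻¹ • y) * v y) y‖ ≤
      (∑ i ∈ Finset.range (2 + 1), (Nat.choose 2 i : ℝ) * M i * C (2 - i)) * k ^ (δ - 2) := by
    refine hL.trans ?_
    rw [Finset.sum_mul]
    refine Finset.sum_le_sum fun i hi => ?_
    have hi2 : i ≤ 2 := by simpa [Nat.lt_succ_iff] using hi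
    have h1 : ‖iteratedFDeriv ℝ i (fun y => η (k⁻¹ • y)) y‖ ≤ k⁻¹ ^ i * M i := by
      rw [norm_iteratedFDeriv_comp_smul _ (inv_pos.2 hk0)]
      exact mul_le_mul_of_nonneg_left (hM i _) (by positivity)
    have h2 : ‖iteratedFDeriv ℝ (2 - i) v y‖ ≤ C (2 - i) * k ^ (δ - (2 - i : ℕ)) := by
      refine (hC (2 - i) y (by linarith [hy.1])).trans ?_
      refine mul_le_mul_of_nonneg_left (Real.rpow_le_rpow_of_nonpos hk0 hy.1 ?_) (hC0 _).le
      have : (0 : ℝ) ≤ (2 - i : ℕ) := Nat.cast_nonneg _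
      linarith
    have h3 : k ^ (δ - 2) = k⁻¹ ^ i * k ^ (δ - (2 - i : ℕ)) := by
      rw [inv_pow, ← Real.rpow_natCast, ← Real.rpow_neg hk0.le, ← Real.rpow_add hk0]
      congr 1
      push_cast [hi2]
      ring
    calc (Nat.choose 2 i : ℝ) * ‖iteratedFDeriv ℝ i (fun y => η (k⁻¹ • y)) y‖ *
          ‖iteratedFDeriv ℝ (2 - i) v y‖
        ≤ (Nat.choose 2 i : ℝ) * (k⁻¹ ^ i * M i) * (C (2 - i) * k ^ (δ - (2 - i : ℕ))) := by
          have := hM0 i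
          gcongr
      _ = _ := by rw [h3]; ring
  have hk2 : 0 ≤ k ^ (δ - 2) := by positivity
  calc (n : ℝ) * ‖iteratedFDeriv ℝ 2 (fun y => η (k⁻¹ • y) * v y) y‖
      ≤ n * ((∑ i ∈ Finset.range (2 + 1), (Nat.choose 2 i : ℝ) * M i * C (2 - i)) *
        k ^ (δ - 2)) := mul_le_mul_of_nonneg_left hsum (Nat.cast_nonneg _)
    _ ≤ _ := by nlinarith

theorem tendsto_integral_regularized_error {e : ℕ → 𝔼 → ℝ} {C b δ : ℝ} (hC : 0 < C)
    (hδ : δ < 0) (hn : 2 ≤ n)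
    (he : ∀ k : ℕ, b < k → ∀ y, |e k y| ≤ C * (k : ℝ) ^ (δ - 2) ∧
      (¬ (k ≤ ‖y‖ ∧ ‖y‖ ≤ 2 * k) → e k y = 0)) (x : 𝔼) :
    Tendsto (fun k : ℕ => ∫ y, (‖y - x‖ ^ 2 + (k : ℝ)⁻¹ ^ 2) ^ ((2 - n : ℝ) / 2) * e k y)
      atTop (𝓝 0) := by
  have hn' : (2 : ℝ) ≤ n := by exact_mod_cast hn
  set B : ℝ := (volume : Measure 𝔼).real (Metric.ball 0 1) with hB
  have hlim : Tendsto (fun k : ℕ => (2⁻¹ : ℝ) ^ (2 - n : ℝ) * C * 2 ^ n * B * (k : ℝ) ^ δ) atTop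
      (𝓝 0) := by
    have := (tendsto_rpow_neg_atTop (y := -δ) (by linarith)).comp
      (tendsto_natCast_atTop_atTop (R := ℝ))
    simpa using this.const_mul ((2⁻¹ : ℝ) ^ (2 - n : ℝ) * C * 2 ^ n * B)
  refine squeeze_zero_norm' ?_ hlim
  filter_upwards [tendsto_natCast_atTop_atTop.eventually_gt_atTop b,
    tendsto_natCast_atTop_atTop.eventually_ge_atTop (2 * ‖x‖),
    tendsto_natCast_atTop_atTop.eventually_gt_atTop (0 : ℝ)] with k hk1 hk2 hk3
  rw [← setIntegral_eq_integral_of_forall_compl_eq_zero (s := Metric.closedBall 0 (2 * k))]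
  swap
  · intro y hy
    rw [(he k hk1 y).2, mul_zero]
    intro h
    exact hy (by simpa using h.2)
  refine (norm_setIntegral_le_of_norm_le_const (C := ((k / 2 : ℝ) ^ 2) ^ ((2 - n : ℝ) / 2) *
    (C * (k : ℝ) ^ (δ - 2))) measure_closedBall_lt_top fun y _ => ?_).trans_eq ?_
  · by_cases hy : k ≤ ‖y‖ ∧ ‖y‖ ≤ 2 * k
    · rw [norm_mul, Real.norm_of_nonneg (by positivity), Real.norm_eq_abs]
      refine mul_le_mul (regularized_rpow_le (by linarith) (by positivity) (by positivity) ?_)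
        (he k hk1 y).1 (abs_nonneg _) (by positivity)
      have := norm_sub_norm_le y x
      linarith [hy.1]
    · rw [(he k hk1 y).2 hy, mul_zero, norm_zero]
      positivity
  · rw [Measure.real, Measure.addHaar_closedBall _ _ (by positivity), ENNReal.toReal_mul,
      ENNReal.toReal_ofReal (by positivity), finrank_euclideanSpace_fin, ← Measure.real, ← hB,
      ← Real.rpow_natCast (k / 2 : ℝ), ← Real.rpow_mul (by positivity), mul_pow]
    have h1 : ((2 : ℕ) : ℝ) * ((2 - n : ℝ) / 2) = 2 - n := by push_cast; ring
    have h2 : (k : ℝ) ^ δ = (k : ℝ) ^ (2 - n : ℝ) * (k : ℝ) ^ (δ - 2) * (k : ℝ) ^ n := by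
      rw [← Real.rpow_natCast, ← Real.rpow_add hk3, ← Real.rpow_add hk3]
      congr 1
      ring
    rw [h1, h2, div_eq_inv_mul, Real.mul_rpow (by norm_num) hk3.le]
    ring

theorem newtonian_representation (hn : 2 ≤ n) {v : 𝔼 → ℝ} (hv : ContDiff ℝ ∞ v) {b δ : ℝ}
    (hb : 0 < b) (hδ : δ < 0) (hlap : ∀ y, b < ‖y‖ → vecLaplacian v y = 0)
    (hdecay : ∀ j : ℕ, ∃ C > 0, ∀ y, b ≤ ‖y‖ → ‖iteratedFDeriv ℝ j v y‖ ≤ C * ‖y‖ ^ (δ - j))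
    {x : 𝔼} (hx : b < ‖x‖) :
    -(n * (n - 2)) * (∫ z : 𝔼, (1 + ‖z‖ ^ 2) ^ (-(n + 2 : ℝ) / 2)) * v x =
      ∫ y, vecLaplacian v y * ‖x - y‖ ^ (2 - n : ℝ) := by
  have hn' : (2 : ℝ) ≤ n := by exact_mod_cast hn
  set η : ContDiffBump (0 : 𝔼) := ⟨1, 2, one_pos, one_lt_two⟩ with hηdef
  have hη : ContDiff ℝ ∞ η := η.contDiff
  obtain ⟨C, hC0, hC⟩ := exists_cutoff_laplacian_bound hv hb hδ hlap hdecay η rfl rfl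
  set φ : ℕ → 𝔼 → ℝ := fun k y => η ((k : ℝ)⁻¹ • y) * v y with hφdef
  have hφ : ∀ k, ContDiff ℝ ∞ (φ k) := fun k => (hη.comp (by fun_prop)).mul hv
  have hφ2 : ∀ k, ContDiff ℝ 2 (φ k) := fun k => (hφ k).of_le (WithTop.coe_le_coe.2 le_top)
  have hv2 : ContDiff ℝ 2 v := hv.of_le (WithTop.coe_le_coe.2 le_top)
  have hcl := hv2.continuous_vecLaplacian
  have hls : HasCompactSupport (vecLaplacian v) :=
    HasCompactSupport.intro (isCompact_closedBall 0 b) fun y hy => hlap y (by simpa using hy)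
  obtain ⟨M, hM⟩ : ∃ M, ∀ y, |v y| ≤ M := by
    obtain ⟨C₀, hC₀, h₀⟩ := hdecay 0
    obtain ⟨M₁, hM₁⟩ := (isCompact_closedBall (0 : 𝔼) b).exists_bound_of_continuousOn
      hv.continuous.continuousOn
    refine ⟨max M₁ (C₀ * b ^ δ), fun y => ?_⟩
    by_cases hy : b ≤ ‖y‖
    · have := h₀ y hy
      rw [norm_iteratedFDeriv_zero, Nat.cast_zero, sub_zero, Real.norm_eq_abs] at this
      refine this.trans (le_max_of_le_right ?_)
      exact mul_le_mul_of_nonneg_left (Real.rpow_le_rpow_of_nonpos hb hy hδ.le) hC₀.le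
    · exact le_max_of_le_left (hM₁ y (by simpa using (not_le.1 hy).le))
  have hφM : ∀ k y, |φ k y| ≤ M := fun k y => by
    rw [hφdef]
    simp only
    rw [abs_mul, abs_of_nonneg η.nonneg]
    exact (mul_le_of_le_one_left (abs_nonneg _) η.le_one).trans (hM y)
  have hφv : ∀ (k : ℕ) (y : 𝔼), ‖y‖ < k → φ k y = v y := fun k y hy => by
    have hk0 : (0 : ℝ) < k := (norm_nonneg y).trans_lt hy
    rw [hφdef]
    simp only
    rw [η.one_of_mem_closedBall, one_mul]
    rw [mem_closedBall_zero_iff, norm_smul, Real.norm_of_nonneg (by positivity)]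
    exact (inv_mul_le_one₀ hk0).2 hy.le
  have hleft := (tendsto_integral_rescaled_mul (fun k => (hφ k).continuous) hφM hv.continuous hφv
    x).const_mul (-(n * (n - 2) : ℝ))
  have hright := (tendsto_integral_regularized_mul (m := (2 - n : ℝ) / 2) (by linarith) hcl hlap
    hx).add (tendsto_integral_regularized_error
      (e := fun k y => vecLaplacian (φ k) y - vecLaplacian v y) hC0 hδ hn
      (fun k hk y => hC k hk y) x)
  rw [add_zero, mul_div_cancel₀ _ two_ne_zero] at hright
  rw [mul_assoc]
  refine tendsto_nhds_unique hleft (hright.congr' ?_)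
  filter_upwards [eventually_ge_atTop 1] with k hk
  have hk0 : (0 : ℝ) < k := by exact_mod_cast hk
  have ht : (0 : ℝ) < (k : ℝ)⁻¹ := inv_pos.2 hk0
  have hφc : HasCompactSupport (φ k) := by
    refine HasCompactSupport.intro (isCompact_closedBall 0 (2 * k)) fun y hy => ?_
    rw [hφdef]
    simp only
    rw [η.zero_of_le_dist, zero_mul]
    rw [dist_zero_right, norm_smul, Real.norm_of_nonneg ht.le, inv_mul_eq_div, le_div_iff₀ hk0]
    rw [mem_closedBall_zero_iff, not_le] at hy
    exact hy.le
  have hΓ : ContDiff ℝ 2 fun y : 𝔼 => (‖y - x‖ ^ 2 + (k : ℝ)⁻¹ ^ 2) ^ ((2 - n : ℝ) / 2) :=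
    (contDiff_regularized_rpow _ (by positivity) x).of_le (WithTop.coe_le_coe.2 le_top)
  have hφl : HasCompactSupport (vecLaplacian (φ k)) := by
    refine HasCompactSupport.intro hφc fun y hy => ?_
    have h0 : φ k =ᶠ[𝓝 y] fun _ => 0 := notMem_tsupport_iff_eventuallyEq.1 hy
    rw [h0.vecLaplacian_eq]
    simp [vecLaplacian]
  have hi1 : Integrable fun y : 𝔼 =>
      (‖y - x‖ ^ 2 + (k : ℝ)⁻¹ ^ 2) ^ ((2 - n : ℝ) / 2) * vecLaplacian v y :=
    (hΓ.continuous.mul hcl).integrable_of_hasCompactSupport hls.mul_left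
  have hi2 : Integrable fun y : 𝔼 =>
      (‖y - x‖ ^ 2 + (k : ℝ)⁻¹ ^ 2) ^ ((2 - n : ℝ) / 2) * vecLaplacian (φ k) y :=
    (hΓ.continuous.mul (hφ2 k).continuous_vecLaplacian).integrable_of_hasCompactSupport
      hφl.mul_left
  simp only [mul_sub]
  rw [integral_sub hi2 hi1, add_sub_cancel, ← integral_vecLaplacian_mul_comm hΓ (hφ2 k) hφc,
    ← integral_regularized_rescale (φ k) x ht, ← integral_const_mul]
  congr 1
  ext y
  rw [vecLaplacian_regularized_rpow (by positivity)]
  ring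

end NewtonianRepresentation

section ExteriorExpansion

variable {n : ℕ}

local notation "𝔼" => EuclideanSpace ℝ (Fin n)

theorem exists_contDiff_eq_of_contDiffOn_exterior {u : 𝔼 → ℝ} {R : ℝ} (hR : 0 < R)
    (hu : ContDiffOn ℝ ∞ u {x | R < ‖x‖}) :
    ∃ v : 𝔼 → ℝ, ContDiff ℝ ∞ v ∧ ∀ x, R + 2 ≤ ‖x‖ → v x = u x := by
  set χ : ContDiffBump (0 : 𝔼) := ⟨R + 1, R + 2, by linarith, by linarith⟩
  refine ⟨fun x => (1 - χ x) * u x, contDiff_iff_contDiffAt.2 fun x => ?_, fun x hx => ?_⟩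
  · by_cases hx : R < ‖x‖
    · have hopen : IsOpen {x : 𝔼 | R < ‖x‖} := isOpen_lt continuous_const continuous_norm
      exact (contDiffAt_const.sub χ.contDiffAt).mul (hu.contDiffAt (hopen.mem_nhds hx))
    · have : (fun x => (1 - χ x) * u x) =ᶠ[𝓝 x] fun _ => 0 := by
        have h1 : ‖x‖ < R + 1 := by linarith
        filter_upwards [continuous_norm.continuousAt.eventually (gt_mem_nhds h1)] with z hz
        rw [χ.one_of_mem_closedBall (mem_closedBall_zero_iff.2 hz.le), sub_self, zero_mul]
      exact contDiffAt_const.congr_of_eventuallyEq this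
  · simp only
    rw [χ.zero_of_le_dist (by rwa [dist_zero_right]), sub_zero, one_mul]

theorem exists_decay_bound_of_bigOInfty {u v : 𝔼 → ℝ} {R δ b : ℝ} (hb : 0 < b) (hδ : δ < 0)
    (hv : ContDiff ℝ ∞ v) (hvu : ∀ x, b ≤ ‖x‖ → v =ᶠ[𝓝 x] u) (hO : BigOInfty u R δ) (j : ℕ) :
    ∃ C > 0, ∀ y, b ≤ ‖y‖ → ‖iteratedFDeriv ℝ j v y‖ ≤ C * ‖y‖ ^ (δ - j) := by
  obtain ⟨C, hC0, R₀, -, hC⟩ := hO j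
  obtain ⟨M, hM⟩ := (isCompact_closedBall (0 : 𝔼) R₀).exists_bound_of_continuousOn
    (hv.continuous_iteratedFDeriv (m := j) (by exact_mod_cast le_top)).continuousOn
  refine ⟨max C (M / R₀ ^ (δ - j)), lt_max_of_lt_left hC0, fun y hy => ?_⟩
  have hy0 : 0 < ‖y‖ := hb.trans_le hy
  by_cases h : R₀ ≤ ‖y‖
  · rw [((hvu y hy).iteratedFDeriv ℝ j).eq_of_nhds]
    refine (hC y h).trans ?_
    gcongr
    exact le_max_left _ _
  · have hlt : ‖y‖ < R₀ := not_le.1 h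
    have hR₀ : 0 < R₀ := hy0.trans hlt
    have h1 := hM y (by simpa using hlt.le)
    have h2 : R₀ ^ (δ - j) ≤ ‖y‖ ^ (δ - j) := by
      refine Real.rpow_le_rpow_of_nonpos hy0 hlt.le ?_
      have : (0 : ℝ) ≤ j := j.cast_nonneg
      linarith
    have hM0 : 0 ≤ M := (norm_nonneg _).trans h1
    calc ‖iteratedFDeriv ℝ j v y‖ ≤ M / R₀ ^ (δ - j) * R₀ ^ (δ - j) := by
          rwa [div_mul_cancel₀ _ (by positivity)]
      _ ≤ max C (M / R₀ ^ (δ - j)) * ‖y‖ ^ (δ - j) := by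
          gcongr
          exact le_max_right _ _

theorem bigOInfty_integral_sub_mul_norm_rpow {f : 𝔼 → ℝ} {b p : ℝ} (R : ℝ) (hb : 0 < b)
    (hp : p ≤ 0) (hf : Continuous f) (hfb : ∀ y, b < ‖y‖ → f y = 0) {u : 𝔼 → ℝ} (κ : ℝ)
    (hu : ∀ x, b < ‖x‖ → u x = κ * ∫ y, f y * ‖x - y‖ ^ p) :
    BigOInfty (fun x => u x - κ * (∫ y, f y) * ‖x‖ ^ p) R (p - 1) := by
  intro j
  set K : 𝔼 → ℝ := fun z => ‖z‖ ^ p with hK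
  have hKs : ∀ z ≠ 0, ContDiffAt ℝ ∞ K z := fun z hz => contDiffAt_norm_rpow p hz
  obtain ⟨C, hC0, hC⟩ := exists_norm_iteratedFDeriv_norm_rpow_sub_le (E := 𝔼) hp j hb
  have hfs : HasCompactSupport f :=
    HasCompactSupport.intro (isCompact_closedBall 0 b) fun y hy => hfb y (by simpa using hy)
  have hfi : Integrable f := hf.integrable_of_hasCompactSupport hfs
  have hA : 0 ≤ ∫ y, |f y| := integral_nonneg fun y => abs_nonneg _
  refine ⟨|κ| * (∫ y, |f y|) * C + 1, by positivity, max R (2 * b), le_max_left _ _,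
    fun x hx => ?_⟩
  have hx2 : 2 * b ≤ ‖x‖ := (le_max_right _ _).trans hx
  have hxb : b < ‖x‖ := by linarith
  have hx0 : x ≠ 0 := norm_pos_iff.1 (hb.trans hxb)
  have hev : (fun x => u x - κ * (∫ y, f y) * ‖x‖ ^ p) =ᶠ[𝓝 x]
      κ • ((fun x => ∫ y, f y • K (x - y)) - (∫ y, f y) • K) := by
    filter_upwards [continuous_norm.continuousAt.eventually (lt_mem_nhds hxb)] with z hz
    simp only [hu z hz, Pi.smul_apply, Pi.sub_apply, smul_eq_mul, hK]
    ring
  have hle : ((j : ℕ) : WithTop ℕ∞) ≤ ∞ := by exact_mod_cast le_top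
  have hF := (contDiffAt_integral_smul_comp_sub (volume : Measure 𝔼) hf hfb hKs hxb).of_le hle
  have hKj := (hKs x hx0).of_le hle
  have hIK : ContDiffAt ℝ j ((∫ y, f y) • K) x := contDiffAt_const.smul hKj
  have hsub : ContDiffAt ℝ j ((fun x => ∫ y, f y • K (x - y)) - (∫ y, f y) • K) x := hF.sub hIK
  have hKc : ∀ z ≠ 0, ContinuousAt (iteratedFDeriv ℝ j K) z := fun z hz =>
    ((hKs z hz).iteratedFDeriv_right (m := 0) (by exact_mod_cast le_top)).continuousAt
  rw [(hev.iteratedFDeriv ℝ j).eq_of_nhds, iteratedFDeriv_const_smul_apply hsub,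
    iteratedFDeriv_sub_apply hF hIK, iteratedFDeriv_const_smul_apply hKj,
    iteratedFDeriv_integral_smul_comp_sub _ hf hfb hKs j hxb, ← integral_smul_const,
    ← integral_sub (integrable_smul_comp_sub _ hf hfb hKc hxb) (hfi.smul_const _), norm_smul,
    Real.norm_eq_abs]
  simp only [← smul_sub]
  have hbound : ‖∫ y, f y • (iteratedFDeriv ℝ j K (x - y) - iteratedFDeriv ℝ j K x)‖ ≤
      ∫ y, |f y| * (C * ‖x‖ ^ (p - 1 - j)) := by
    refine norm_integral_le_of_norm_le (hfi.abs.mul_const _) (Eventually.of_forall fun y => ?_)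
    by_cases hy : b < ‖y‖
    · simp [hfb y hy]
    · rw [norm_smul, Real.norm_eq_abs]
      exact mul_le_mul_of_nonneg_left (hC x y (not_lt.1 hy) hx2) (abs_nonneg _)
  rw [integral_mul_const] at hbound
  have hpos : 0 ≤ ‖x‖ ^ (p - 1 - j) := by positivity
  calc |κ| * ‖∫ y, f y • (iteratedFDeriv ℝ j K (x - y) - iteratedFDeriv ℝ j K x)‖
      ≤ |κ| * ((∫ y, |f y|) * (C * ‖x‖ ^ (p - 1 - j))) := by gcongr
    _ ≤ (|κ| * (∫ y, |f y|) * C + 1) * ‖x‖ ^ (p - 1 - j) := by linarith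

theorem exists_exterior_harmonic_expansion (hn : 3 ≤ n) {u : 𝔼 → ℝ} {R δ : ℝ} (hR : 0 < R)
    (hδ : δ < 0) (hu : IsHarmonicOn u {x | R < ‖x‖}) (hO : BigOInfty u R δ) :
    ∃ c : ℝ, BigOInfty (fun x => u x - c * ‖x‖ ^ (2 - n : ℝ)) R (1 - n) := by
  have hn' : (3 : ℝ) ≤ n := by exact_mod_cast hn
  obtain ⟨v, hv, hvu⟩ := exists_contDiff_eq_of_contDiffOn_exterior hR hu.1
  have hvu' : ∀ x, R + 3 ≤ ‖x‖ → v =ᶠ[𝓝 x] u := by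
    intro x hx
    have h1 : R + 2 < ‖x‖ := by linarith
    filter_upwards [continuous_norm.continuousAt.eventually (lt_mem_nhds h1)] with z hz
    exact hvu z hz.le
  have hlap : ∀ y, R + 3 < ‖y‖ → vecLaplacian v y = 0 := fun y hy => by
    rw [(hvu' y hy.le).vecLaplacian_eq]
    exact hu.2 y (lt_trans (by linarith) hy)
  set A : ℝ := ∫ z : 𝔼, (1 + ‖z‖ ^ 2) ^ (-(n + 2 : ℝ) / 2) with hA
  have hA0 : 0 < A := by
    have hint : Integrable fun z : 𝔼 => (1 + ‖z‖ ^ 2) ^ (-(n + 2 : ℝ) / 2) :=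
      integrable_rpow_neg_one_add_norm_sq (by rw [finrank_euclideanSpace_fin]; linarith)
    have hcont : Continuous fun z : 𝔼 => (1 + ‖z‖ ^ 2) ^ (-(n + 2 : ℝ) / 2) :=
      Continuous.rpow_const (by fun_prop) fun z => Or.inl (ne_of_gt (by positivity))
    exact integral_pos_of_integrable_nonneg_nonzero hcont hint (fun z => by positivity) (x := 0)
      (by simp)
  have hκ : (-(n * (n - 2)) * A : ℝ) ≠ 0 := by
    have h1 : (0 : ℝ) < n * (n - 2) := mul_pos (by linarith) (by linarith)
    exact mul_ne_zero (neg_ne_zero.2 h1.ne') hA0.ne'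
  have hb : 0 < R + 3 := by linarith
  have hrep : ∀ x, R + 3 < ‖x‖ → u x = (-(n * (n - 2)) * A : ℝ)⁻¹ *
      ∫ y, vecLaplacian v y * ‖x - y‖ ^ (2 - n : ℝ) := fun x hx => by
    rw [← newtonian_representation (by linarith) hv hb hδ hlap
      (exists_decay_bound_of_bigOInfty hb hδ hv hvu' hO) hx, ← hA, inv_mul_cancel_left₀ hκ,
      (hvu' x hx.le).eq_of_nhds]
  have hcl := (hv.of_le (WithTop.coe_le_coe.2 le_top : (2 : WithTop ℕ∞) ≤
    ∞)).continuous_vecLaplacian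
  have := bigOInfty_integral_sub_mul_norm_rpow R hb (by linarith) hcl hlap _ hrep
  rw [show (2 - n - 1 : ℝ) = 1 - n by ring] at this
  exact ⟨_, this⟩

end ExteriorExpansion

section VectorFields

variable {n : ℕ}

local notation "𝔼" => EuclideanSpace ℝ (Fin n)

theorem iteratedFDeriv_apply_coord {w : 𝔼 → 𝔼} {x : 𝔼} {j : ℕ} (hw : ContDiffAt ℝ j w x)
    (i : Fin n) (m : Fin j → 𝔼) :
    iteratedFDeriv ℝ j (fun y => w y i) x m = iteratedFDeriv ℝ j w x m i := by
  have h := (EuclideanSpace.proj i : 𝔼 →L[ℝ] ℝ).iteratedFDeriv_comp_left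
    hw (i := j) le_rfl
  exact congrArg (fun L : ContinuousMultilinearMap ℝ (fun _ : Fin j => 𝔼) ℝ => L m) h

theorem norm_iteratedFDeriv_coord_le {w : 𝔼 → 𝔼} {x : 𝔼} {j : ℕ} (hw : ContDiffAt ℝ j w x)
    (i : Fin n) :
    ‖iteratedFDeriv ℝ j (fun y => w y i) x‖ ≤ ‖iteratedFDeriv ℝ j w x‖ := by
  refine ContinuousMultilinearMap.opNorm_le_bound (norm_nonneg _) fun m => ?_
  rw [iteratedFDeriv_apply_coord hw]
  exact (PiLp.norm_apply_le _ i).trans (ContinuousMultilinearMap.le_opNorm _ _)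

theorem norm_iteratedFDeriv_le_sum_coord {w : 𝔼 → 𝔼} {x : 𝔼} {j : ℕ}
    (hw : ContDiffAt ℝ j w x) :
    ‖iteratedFDeriv ℝ j w x‖ ≤ ∑ i, ‖iteratedFDeriv ℝ j (fun y => w y i) x‖ := by
  refine ContinuousMultilinearMap.opNorm_le_bound
    (Finset.sum_nonneg fun i _ => norm_nonneg _) fun m => ?_
  rw [Finset.sum_mul]
  calc ‖iteratedFDeriv ℝ j w x m‖
      = ‖∑ i, EuclideanSpace.single i (iteratedFDeriv ℝ j w x m i)‖ := by
        congr 1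
        ext k
        simp
    _ ≤ ∑ i, ‖EuclideanSpace.single i (iteratedFDeriv ℝ j w x m i)‖ := norm_sum_le _ _
    _ ≤ _ := by
        refine Finset.sum_le_sum fun i _ => ?_
        rw [PiLp.norm_single, ← iteratedFDeriv_apply_coord hw]
        exact ContinuousMultilinearMap.le_opNorm _ _

theorem bigOInfty_coord {w : 𝔼 → 𝔼} {R α : ℝ} (hw : ContDiffOn ℝ ∞ w {x | R < ‖x‖})
    (hO : BigOInfty w R α) (i : Fin n) : BigOInfty (fun x => w x i) R α := by
  intro j
  obtain ⟨C, hC0, R₀, hR₀, hC⟩ := hO j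
  refine ⟨C, hC0, max R₀ (R + 1), hR₀.trans (le_max_left _ _), fun x hx => ?_⟩
  have hopen : IsOpen {x : 𝔼 | R < ‖x‖} := isOpen_lt continuous_const continuous_norm
  have hxR : R < ‖x‖ := (lt_add_one R).trans_le ((le_max_right _ _).trans hx)
  exact (norm_iteratedFDeriv_coord_le ((hw.contDiffAt (hopen.mem_nhds hxR)).of_le
    (by exact_mod_cast le_top)) i).trans (hC x ((le_max_left _ _).trans hx))

theorem bigOInfty_of_coord {w : 𝔼 → 𝔼} {R α : ℝ} (hw : ContDiffOn ℝ ∞ w {x | R < ‖x‖})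
    (hO : ∀ i, BigOInfty (fun x => w x i) R α) : BigOInfty w R α := by
  intro j
  choose C hC0 r hr hC using fun i => hO i j
  have hopen : IsOpen {x : 𝔼 | R < ‖x‖} := isOpen_lt continuous_const continuous_norm
  have hC1 : 0 ≤ ∑ i, C i := Finset.sum_nonneg fun i _ => (hC0 i).le
  refine ⟨∑ i, C i + 1, by positivity, max (R + 1) (∑ i, |r i|), (lt_add_one R).le.trans
    (le_max_left _ _), fun x hx => ?_⟩
  have hxR : R < ‖x‖ := (lt_add_one R).trans_le ((le_max_left _ _).trans hx)
  have hxr : ∀ i, r i ≤ ‖x‖ := fun i => (le_abs_self _).trans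
    ((Finset.single_le_sum (f := fun i => |r i|) (fun i _ => abs_nonneg _)
      (Finset.mem_univ i)).trans ((le_max_right _ _).trans hx))
  refine (norm_iteratedFDeriv_le_sum_coord ((hw.contDiffAt (hopen.mem_nhds hxR)).of_le
    (by exact_mod_cast le_top))).trans ((Finset.sum_le_sum fun i _ => hC i x (hxr i)).trans ?_)
  rw [← Finset.sum_mul]
  gcongr
  linarith

theorem fderiv_norm_rpow_apply (p : ℝ) {x : 𝔼} (hx : x ≠ 0) (y : 𝔼) :
    fderiv ℝ (fun z : 𝔼 => ‖z‖ ^ p) x y = p * ‖x‖ ^ (p - 2) * inner ℝ x y := by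
  have hx0 : 0 < ‖x‖ := norm_pos_iff.2 hx
  have h : HasFDerivAt (fun z : 𝔼 => (‖z‖ ^ 2) ^ (p / 2))
      ((p / 2 * (‖x‖ ^ 2) ^ (p / 2 - 1)) • (2 • innerSL ℝ x)) x :=
    (hasStrictFDerivAt_norm_sq x).hasFDerivAt.rpow_const (Or.inl (by positivity))
  have he : (fun z : 𝔼 => ‖z‖ ^ p) = fun z : 𝔼 => (‖z‖ ^ 2) ^ (p / 2) := by
    funext z
    rw [← Real.rpow_natCast, ← Real.rpow_mul (norm_nonneg z)]
    congr 1
    push_cast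
    ring
  have h2 : (‖x‖ ^ 2) ^ (p / 2 - 1) = ‖x‖ ^ (p - 2) := by
    rw [← Real.rpow_natCast, ← Real.rpow_mul hx0.le]
    congr 1
    push_cast
    ring
  rw [he, h.fderiv, h2]
  simp
  ring

theorem eq_zero_of_mul_rpow_le {a A B p q s t₀ : ℝ} (ha : 0 ≤ a) (hp : p < s)
    (hq : q < s) (h : ∀ t ≥ t₀, a * t ^ s ≤ A * t ^ p + B * t ^ q) : a = 0 := by
  have h1 : ∀ r < s, Tendsto (fun t : ℝ => t ^ (r - s)) atTop (𝓝 0) := fun r hr => by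
    have := tendsto_rpow_neg_atTop (y := s - r) (by linarith)
    simpa using this
  have h2 : Tendsto (fun t : ℝ => A * t ^ (p - s) + B * t ^ (q - s)) atTop (𝓝 0) := by
    simpa using ((h1 p hp).const_mul A).add ((h1 q hq).const_mul B)
  refine le_antisymm (ge_of_tendsto h2 ?_) ha
  filter_upwards [eventually_ge_atTop t₀, eventually_gt_atTop 0] with t ht ht0
  have h3 := h t ht
  have ht1 : 0 < t ^ s := Real.rpow_pos_of_pos ht0 s
  rw [Real.rpow_sub ht0, Real.rpow_sub ht0, ← mul_div_assoc, ← mul_div_assoc, ← add_div,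
    le_div_iff₀ ht1]
  exact h3

theorem divergence_eq_of_expansion {w : 𝔼 → 𝔼} {x c : 𝔼} {p : ℝ} (hx : x ≠ 0)
    (hw : ∀ i, DifferentiableAt ℝ (fun y => w y i) x) :
    divergence w x = p * ‖x‖ ^ (p - 2) * inner ℝ x c +
      ∑ i, fderiv ℝ (fun y => w y i - c i * ‖y‖ ^ p) x (EuclideanSpace.single i 1) := by
  have hK : DifferentiableAt ℝ (fun z : 𝔼 => ‖z‖ ^ p) x :=
    (contDiffAt_norm_rpow p hx).differentiableAt (by simp)
  have h : ∀ i, fderiv ℝ (fun y => w y i - c i * ‖y‖ ^ p) x (EuclideanSpace.single i 1) =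
      fderiv ℝ (fun y => w y i) x (EuclideanSpace.single i 1) -
        p * ‖x‖ ^ (p - 2) * (c i * x i) := fun i => by
    rw [fderiv_fun_sub (hw i) (hK.const_mul (c i)), fderiv_const_mul hK]
    simp only [sub_apply, smul_apply, smul_eq_mul,
      fderiv_norm_rpow_apply p hx, EuclideanSpace.inner_single_right]
    simp
    ring
  rw [Finset.sum_congr rfl fun i _ => h i, Finset.sum_sub_distrib, ← Finset.mul_sum,
    divergence, PiLp.inner_apply]
  simp

theorem coefficient_eq_zero_of_divergence_bound (hn : 3 ≤ n) {w : 𝔼 → 𝔼} {c : 𝔼} {R ε : ℝ}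
    (hR : 0 < R) (hε : 0 < ε) (hw : ∀ i, ContDiffOn ℝ ∞ (fun x => w x i) {x | R < ‖x‖})
    (hexp : ∀ i, BigOInfty (fun x => w x i - c i * ‖x‖ ^ (2 - n : ℝ)) R (1 - n))
    (hdiv : BigOInfty (divergence w) R (1 - n - ε)) : c = 0 := by
  by_contra hc
  have hn' : (3 : ℝ) ≤ n := by exact_mod_cast hn
  have hc0 : 0 < ‖c‖ := norm_pos_iff.2 hc
  choose A hA0 r hr hA using fun i => hexp i 1
  obtain ⟨B, hB0, R₁, hR₁, hB⟩ := hdiv 0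
  have hopen : IsOpen {x : 𝔼 | R < ‖x‖} := isOpen_lt continuous_const continuous_norm
  have key : (n - 2 : ℝ) * ‖c‖ = 0 := by
    refine eq_zero_of_mul_rpow_le (t₀ := max (R + 1) (max R₁ (∑ i, |r i|)))
      (A := ∑ i, A i) (B := B) (s := 1 - n) (p := -n) (q := 1 - n - ε)
      (mul_nonneg (by linarith) hc0.le) (by linarith) (by linarith) fun t ht => ?_
    have htR : R + 1 ≤ t := (le_max_left _ _).trans ht
    have htR₁ : R₁ ≤ t := (le_max_left _ _).trans ((le_max_right _ _).trans ht)
    have htr : ∀ i, r i ≤ t := fun i => (le_abs_self _).trans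
      ((Finset.single_le_sum (f := fun i => |r i|) (fun i _ => abs_nonneg _)
        (Finset.mem_univ i)).trans ((le_max_right _ _).trans ((le_max_right _ _).trans ht)))
    have ht0 : 0 < t := by linarith
    set x : 𝔼 := (t / ‖c‖) • c with hxdef
    have hxt : ‖x‖ = t := by
      rw [hxdef, norm_smul, Real.norm_of_nonneg (by positivity), div_mul_cancel₀ _ hc0.ne']
    have hx0 : x ≠ 0 := norm_pos_iff.1 (hxt ▸ ht0)
    have hxin : inner ℝ x c = t * ‖c‖ := by
      rw [hxdef, real_inner_smul_left, real_inner_self_eq_norm_sq]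
      field_simp
    have hdiff : ∀ i, DifferentiableAt ℝ (fun y => w y i) x := fun i =>
      ((hw i).contDiffAt (hopen.mem_nhds (by rw [Set.mem_ofPred_eq, hxt]; linarith))
        ).differentiableAt (by simp)
    have hd := divergence_eq_of_expansion (p := (2 - n : ℝ)) (c := c) hx0 hdiff
    have hb : |divergence w x| ≤ B * t ^ (1 - n - ε : ℝ) := by
      have := hB x (by rwa [hxt])
      rwa [norm_iteratedFDeriv_zero, Real.norm_eq_abs, hxt, Nat.cast_zero, sub_zero] at this
    have hs : |∑ i, fderiv ℝ (fun y => w y i - c i * ‖y‖ ^ (2 - n : ℝ)) x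
        (EuclideanSpace.single i 1)| ≤ (∑ i, A i) * t ^ (-n : ℝ) := by
      rw [Finset.sum_mul]
      refine (Finset.abs_sum_le_sum_abs _ _).trans (Finset.sum_le_sum fun i _ => ?_)
      have h1 := hA i x (by rw [hxt]; exact htr i)
      rw [norm_iteratedFDeriv_one, hxt, show (1 - n - (1 : ℕ) : ℝ) = -n by push_cast; ring] at h1
      simpa using ContinuousLinearMap.le_of_opNorm_le _ h1 (EuclideanSpace.single i 1)
    have hpow : t ^ (2 - n - 2 : ℝ) * t = t ^ (1 - n : ℝ) := by
      rw [← Real.rpow_add_one ht0.ne']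
      congr 1
      ring
    rw [hxin, hxt] at hd
    have hd' : (n - 2 : ℝ) * ‖c‖ * t ^ (1 - n : ℝ) = ∑ i, fderiv ℝ
        (fun y => w y i - c i * ‖y‖ ^ (2 - n : ℝ)) x (EuclideanSpace.single i 1) -
        divergence w x := by
      rw [hd, ← hpow]
      ring
    rw [hd']
    linarith [le_abs_self (∑ i, fderiv ℝ (fun y => w y i - c i * ‖y‖ ^ (2 - n : ℝ)) x
      (EuclideanSpace.single i 1)), neg_abs_le (divergence w x)]
  exact absurd key (mul_pos (by linarith) hc0).ne'

theorem bigOInfty_one_sub_of_divergence_bound (hn : 3 ≤ n) {R δ ε : ℝ} (hR : 0 < R) (hδ : δ < 0)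
    (hε : 0 < ε) {w : 𝔼 → 𝔼} (hharm : ∀ i, IsHarmonicOn (fun x => w x i) {x | R < ‖x‖})
    (hO : BigOInfty w R δ) (hdiv : BigOInfty (divergence w) R (1 - n - ε)) :
    BigOInfty w R (1 - n) := by
  have hw : ContDiffOn ℝ ∞ w {x | R < ‖x‖} := contDiffOn_euclidean.2 fun i => (hharm i).1
  choose c hc using fun i =>
    exists_exterior_harmonic_expansion hn hR hδ (hharm i) (bigOInfty_coord hw hO i)
  have hc0 : WithLp.toLp 2 c = (0 : 𝔼) :=
    coefficient_eq_zero_of_divergence_bound hn hR hε (fun i => (hharm i).1) hc hdiv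
  refine bigOInfty_of_coord hw fun i => ?_
  have hci : c i = 0 := congrArg (fun z : 𝔼 => z i) hc0
  simpa [hci] using hc i

end VectorFields

end

/-- Let `n ≥ 3`, `R > 0`, `δ < 0`, `ε > 0`, and let `ω : {x ∈ ℝⁿ : |x| > R} → ℝⁿ` be a
smooth vector field with each component harmonic, `ω = 𝒪_∞(r^δ)` and
`div ω = 𝒪_∞(r^{1−n−ε})`. Then `ω = 𝒪_∞(r^{1−n})`. -/
theorem harmonic_vector_field_decays_one_sub_n (n : ℕ) (hn : 3 ≤ n)
    (R : ℝ) (hR : 0 < R) (δ ε : ℝ) (hδ : δ < 0) (hε : 0 < ε)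
    (ω : EuclideanSpace ℝ (Fin n) → EuclideanSpace ℝ (Fin n))
    (hharm : ∀ i : Fin n, IsHarmonicOn (fun x => ω x i) {x | R < ‖x‖})
    (hO : BigOInfty ω R δ)
    (hdiv : BigOInfty (divergence ω) R (1 - (n : ℝ) - ε)) :
    BigOInfty ω R (1 - (n : ℝ)) := by
  exact bigOInfty_one_sub_of_divergence_bound hn hR hδ hε hharm hO hdiv
end

section
/- Let n ≥ 3, R > 0 and ε > 0, and let ω = (ω₁, …, ω_n) : {x ∈ ℝⁿ : |x| > R} → ℝⁿ be a smooth vector field with each component harmonic, satisfying ω = 𝒪_∞(r^{1−n}), ∂ω_j/∂x_i = ∂ω_i/∂x_j for all i, j (i.e. the associated 1-form is closed), and div ω = ∑_{i=1}^n ∂ω_i/∂x_i = 𝒪_∞(r^{−n−ε}). Then there exists B ∈ ℝ such that ω(x) = B |x|^{−n} x + O(|x|^{−n}) as |x| → ∞. -/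
open MeasureTheory Filter Topology

/-- `g` is `C²` on `ℝⁿ` and its value, its partial derivatives and its pure second partial
derivatives decay like `r^{-a}`, `r^{-a-1}` and `r^{-a-2}` respectively. -/
def HasDecay {n : ℕ} (g : EuclideanSpace ℝ (Fin n) → ℝ) (a : ℝ) : Prop :=
  ContDiff ℝ 2 g ∧ ∀ i : Fin n, ∃ C : ℝ, ∀ y,
    |g y| ≤ C * (1 + ‖y‖) ^ (-a) ∧
    |fderiv ℝ g y (EuclideanSpace.single i 1)| ≤ C * (1 + ‖y‖) ^ (-(a + 1)) ∧
    |fderiv ℝ (fun z => fderiv ℝ g z (EuclideanSpace.single i 1)) y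
      (EuclideanSpace.single i 1)| ≤ C * (1 + ‖y‖) ^ (-(a + 2))

lemma ContDiff.fderiv_apply_const {E : Type*} [NormedAddCommGroup E] [NormedSpace ℝ E]
    {g : E → ℝ} (hg : ContDiff ℝ 2 g) (v : E) : ContDiff ℝ 1 (fun z => fderiv ℝ g z v) :=
  (hg.fderiv_right (m := 1) (by norm_num)).clm_apply contDiff_const

lemma ContDiff.continuous_fderiv_fderiv_apply {E : Type*} [NormedAddCommGroup E]
    [NormedSpace ℝ E] {g : E → ℝ} (hg : ContDiff ℝ 2 g) (v : E) :
    Continuous (fun y => fderiv ℝ (fun z => fderiv ℝ g z v) y v) :=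
  ((hg.fderiv_apply_const v).continuous_fderiv (by norm_num)).clm_apply continuous_const

lemma integrable_mul_of_decay {n : ℕ} {f g : EuclideanSpace ℝ (Fin n) → ℝ}
    (hf : Continuous f) (hg : Continuous g) {a b C D : ℝ} (hab : (n : ℝ) < a + b)
    (hfa : ∀ y, |f y| ≤ C * (1 + ‖y‖) ^ (-a)) (hgb : ∀ y, |g y| ≤ D * (1 + ‖y‖) ^ (-b)) :
    Integrable (fun y => f y * g y) := by
  have hI : Integrable (fun y : EuclideanSpace ℝ (Fin n) => C * D * (1 + ‖y‖) ^ (-(a + b))) :=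
    (integrable_one_add_norm (by simpa using hab)).const_mul _
  refine hI.mono' (hf.mul hg).aestronglyMeasurable (Eventually.of_forall fun y => ?_)
  have h1 : 0 < 1 + ‖y‖ := by positivity
  rw [Real.norm_eq_abs, abs_mul, neg_add, Real.rpow_add h1]
  calc |f y| * |g y| ≤ (C * (1 + ‖y‖) ^ (-a)) * (D * (1 + ‖y‖) ^ (-b)) :=
        mul_le_mul (hfa y) (hgb y) (abs_nonneg _) ((abs_nonneg _).trans (hfa y))
    _ = _ := by ring

/-- Green's second identity without boundary term, for decaying functions. -/
lemma integral_mul_vecLaplacian {n : ℕ} {g w : EuclideanSpace ℝ (Fin n) → ℝ} {a b : ℝ}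
    (hab : (n : ℝ) < a + b + 1) (hg : HasDecay g a) (hw : HasDecay w b) :
    ∫ y, g y * vecLaplacian w y = ∫ y, vecLaplacian g y * w y := by
  obtain ⟨hg, hgd⟩ := hg
  obtain ⟨hw, hwd⟩ := hw
  choose C hC using hgd
  choose D hD using hwd
  have hgv := fun i : Fin n => hg.fderiv_apply_const (EuclideanSpace.single i (1 : ℝ))
  have hwv := fun i : Fin n => hw.fderiv_apply_const (EuclideanSpace.single i (1 : ℝ))
  have hgvv := fun i : Fin n =>
    hg.continuous_fderiv_fderiv_apply (EuclideanSpace.single i (1 : ℝ))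
  have hwvv := fun i : Fin n =>
    hw.continuous_fderiv_fderiv_apply (EuclideanSpace.single i (1 : ℝ))
  have i02 := fun i => integrable_mul_of_decay (a := a) (b := b + 2) hg.continuous (hwvv i)
    (by linarith) (fun y => (hC i y).1) (fun y => (hD i y).2.2)
  have i20 := fun i => integrable_mul_of_decay (a := a + 2) (b := b) (hgvv i) hw.continuous
    (by linarith) (fun y => (hC i y).2.2) (fun y => (hD i y).1)
  have i01 := fun i => integrable_mul_of_decay (a := a) (b := b + 1) hg.continuous
    (hwv i).continuous (by linarith) (fun y => (hC i y).1) (fun y => (hD i y).2.1)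
  have i10 := fun i => integrable_mul_of_decay (a := a + 1) (b := b) (hgv i).continuous
    hw.continuous (by linarith) (fun y => (hC i y).2.1) (fun y => (hD i y).1)
  have i11 := fun i => integrable_mul_of_decay (a := a + 1) (b := b + 1) (hgv i).continuous
    (hwv i).continuous (by linarith) (fun y => (hC i y).2.1) (fun y => (hD i y).2.1)
  simp only [vecLaplacian, Finset.mul_sum, Finset.sum_mul]
  rw [integral_finsetSum _ fun i _ => i02 i, integral_finsetSum _ fun i _ => i20 i]
  refine Finset.sum_congr rfl fun i _ => ?_
  rw [integral_mul_fderiv_eq_neg_fderiv_mul_of_integrable (i11 i) (i02 i) (i01 i)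
      (fun x _ => (hg.differentiable (by norm_num)) x)
      (fun x _ => ((hwv i).differentiable (by norm_num)) x),
    integral_mul_fderiv_eq_neg_fderiv_mul_of_integrable (i20 i) (i11 i) (i10 i)
      (fun x _ => ((hgv i).differentiable (by norm_num)) x)
      (fun x _ => (hw.differentiable (by norm_num)) x), neg_neg]

section Kernel

variable {E : Type*} [NormedAddCommGroup E] [InnerProductSpace ℝ E]

lemma hasFDerivAt_norm_sub_sq_add_rpow (x : E) {d : ℝ} (hd : 0 < d) (p : ℝ) (y : E) :
    HasFDerivAt (fun y => (‖y - x‖ ^ 2 + d) ^ p)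
      ((2 * p * (‖y - x‖ ^ 2 + d) ^ (p - 1)) • innerSL ℝ (y - x)) y := by
  have h1 : HasFDerivAt (fun y => ‖y - x‖ ^ 2 + d) (2 • innerSL ℝ (y - x)) y := by
    simpa using (((hasFDerivAt_id y).sub_const x).norm_sq).add_const d
  have h2 := h1.rpow_const (p := p) (Or.inl (by positivity))
  refine h2.congr_fderiv ?_
  ext v
  simp
  ring

lemma fderiv_norm_sub_sq_add_rpow (x : E) {d : ℝ} (hd : 0 < d) (p : ℝ) (y v : E) :
    fderiv ℝ (fun y => (‖y - x‖ ^ 2 + d) ^ p) y v =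
      2 * p * (‖y - x‖ ^ 2 + d) ^ (p - 1) * inner ℝ (y - x) v := by
  rw [(hasFDerivAt_norm_sub_sq_add_rpow x hd p y).fderiv]
  simp [inner_sub_left]

lemma fderiv_fderiv_norm_sub_sq_add_rpow (x : E) {d : ℝ} (hd : 0 < d) (p : ℝ) (y v : E) :
    fderiv ℝ (fun z => fderiv ℝ (fun y => (‖y - x‖ ^ 2 + d) ^ p) z v) y v =
      2 * p * (2 * (p - 1) * (‖y - x‖ ^ 2 + d) ^ (p - 2) * inner ℝ (y - x) v ^ 2 +
        (‖y - x‖ ^ 2 + d) ^ (p - 1) * ‖v‖ ^ 2) := by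
  simp_rw [fderiv_norm_sub_sq_add_rpow x hd p]
  have h1 := hasFDerivAt_norm_sub_sq_add_rpow x hd (p - 1) y
  have h2 : HasFDerivAt (fun z : E => inner ℝ (z - x) v) (innerSL ℝ v) y := by
    have := ((innerSL ℝ v).hasFDerivAt (x := y - x)).comp y ((hasFDerivAt_id y).sub_const x)
    refine (this.congr_fderiv (by ext; simp)).congr_of_eventuallyEq ?_
    filter_upwards with z
    simp [real_inner_comm]
  have h3 := (h1.const_mul (2 * p)).mul h2
  rw [show p - 1 - 1 = p - 2 by ring] at h3
  refine (congrArg (fun L => L v) h3.fderiv).trans ?_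
  simp only [add_apply, smul_apply, innerSL_apply_apply,
    smul_eq_mul, real_inner_self_eq_norm_sq]
  ring

lemma contDiff_norm_sub_sq_add_rpow (x : E) {d : ℝ} (hd : 0 < d) (p : ℝ) :
    ContDiff ℝ 2 (fun y : E => (‖y - x‖ ^ 2 + d) ^ p) := by
  refine ContDiff.rpow_const_of_ne (((contDiff_id.sub contDiff_const).norm_sq ℝ).add
    contDiff_const) fun y => ?_
  positivity

end Kernel

lemma hasDecay_norm_sub_sq_add_rpow {n : ℕ} (x : EuclideanSpace ℝ (Fin n)) {d : ℝ}
    (hd : 0 < d) {a : ℝ} (ha : 0 ≤ a) :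
    HasDecay (fun y => (‖y - x‖ ^ 2 + d) ^ (-a / 2)) a := by
  refine ⟨contDiff_norm_sub_sq_add_rpow x hd _, fun i => ?_⟩
  have hM : 0 < (1 + ‖x‖) / √d + 1 := by positivity
  set M := (1 + ‖x‖) / √d + 1
  have hq : ∀ y : EuclideanSpace ℝ (Fin n), 1 + ‖y‖ ≤ M * √(‖y - x‖ ^ 2 + d) := by
    intro y
    have h1 : √d ≤ √(‖y - x‖ ^ 2 + d) := Real.sqrt_le_sqrt (by nlinarith [sq_nonneg ‖y - x‖])
    have h2 : ‖y - x‖ ≤ √(‖y - x‖ ^ 2 + d) := Real.le_sqrt_of_sq_le (by linarith)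
    have h3 : ‖y‖ ≤ ‖x‖ + ‖y - x‖ := by simpa using norm_add_le x (y - x)
    have h4 : 1 + ‖x‖ ≤ (1 + ‖x‖) / √d * √(‖y - x‖ ^ 2 + d) := by
      rw [div_mul_eq_mul_div, le_div_iff₀ (Real.sqrt_pos.2 hd)]
      gcongr
    simp only [M]
    linarith
  have hpow : ∀ b : ℝ, 0 ≤ b → ∀ y : EuclideanSpace ℝ (Fin n),
      (‖y - x‖ ^ 2 + d) ^ (-b / 2) ≤ M ^ b * (1 + ‖y‖) ^ (-b) := by
    intro b hb y
    have hQ : 0 < ‖y - x‖ ^ 2 + d := by positivity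
    have e1 : (‖y - x‖ ^ 2 + d) ^ (-b / 2) = (√(‖y - x‖ ^ 2 + d)) ^ (-b) := by
      rw [Real.sqrt_eq_rpow, ← Real.rpow_mul hQ.le]
      congr 1
      ring
    have e2 : M ^ b * (1 + ‖y‖) ^ (-b) = ((1 + ‖y‖) / M) ^ (-b) := by
      rw [Real.div_rpow (by positivity) hM.le, Real.rpow_neg hM.le]
      field_simp
    rw [e1, e2]
    refine Real.rpow_le_rpow_of_nonpos (by positivity) ?_ (by linarith)
    rw [div_le_iff₀ hM, mul_comm]
    exact hq y
  have hin : ∀ y : EuclideanSpace ℝ (Fin n),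
      |inner ℝ (y - x) (EuclideanSpace.single i (1 : ℝ))| ≤ (‖y - x‖ ^ 2 + d) ^ (1 / 2 : ℝ) := by
    intro y
    have h := abs_real_inner_le_norm (y - x) (EuclideanSpace.single i (1 : ℝ))
    simp only [PiLp.norm_single, norm_one, mul_one] at h
    rw [← Real.sqrt_eq_rpow]
    exact h.trans (Real.le_sqrt_of_sq_le (by linarith))
  refine ⟨max (M ^ a) (max (a * M ^ (a + 1)) (a * (a + 3) * M ^ (a + 2))),
    fun y => ⟨?_, ?_, ?_⟩⟩
  · rw [abs_of_nonneg (by positivity)]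
    refine (hpow a ha y).trans ?_
    gcongr
    exact le_max_left _ _
  · have hQ : 0 < ‖y - x‖ ^ 2 + d := by positivity
    rw [fderiv_norm_sub_sq_add_rpow x hd, abs_mul, abs_mul,
      abs_of_nonneg (Real.rpow_nonneg hQ.le _), show |2 * (-a / 2)| = a by
        rw [show 2 * (-a / 2) = -a by ring, abs_neg, abs_of_nonneg ha]]
    calc _ ≤ a * (‖y - x‖ ^ 2 + d) ^ (-a / 2 - 1) * (‖y - x‖ ^ 2 + d) ^ (1 / 2 : ℝ) := by
          gcongr
          exact hin y
      _ = a * (‖y - x‖ ^ 2 + d) ^ (-(a + 1) / 2) := by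
          rw [mul_assoc, ← Real.rpow_add hQ]
          congr 2
          ring
      _ ≤ a * (M ^ (a + 1) * (1 + ‖y‖) ^ (-(a + 1))) := by
          gcongr
          exact hpow _ (by linarith) y
      _ = (a * M ^ (a + 1)) * (1 + ‖y‖) ^ (-(a + 1)) := by ring
      _ ≤ _ := by
          gcongr
          exact (le_max_left _ _).trans (le_max_right _ _)
  · have hQ : 0 < ‖y - x‖ ^ 2 + d := by positivity
    rw [fderiv_fderiv_norm_sub_sq_add_rpow x hd]
    have h1 : (‖y - x‖ ^ 2 + d) ^ (-a / 2 - 2) *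
        inner ℝ (y - x) (EuclideanSpace.single i (1 : ℝ)) ^ 2 ≤
        (‖y - x‖ ^ 2 + d) ^ (-a / 2 - 1) := by
      calc _ ≤ (‖y - x‖ ^ 2 + d) ^ (-a / 2 - 2) * ((‖y - x‖ ^ 2 + d) ^ (1 / 2 : ℝ)) ^ 2 := by
            gcongr ?_ * ?_
            rw [← sq_abs]
            exact pow_le_pow_left₀ (abs_nonneg _) (hin y) 2
        _ = _ := by
            rw [← Real.rpow_natCast (_ ^ (1 / 2 : ℝ)) 2, ← Real.rpow_mul hQ.le, ← Real.rpow_add hQ]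
            congr 1
            push_cast
            ring
    have h0 : 0 ≤ (‖y - x‖ ^ 2 + d) ^ (-a / 2 - 2) *
        inner ℝ (y - x) (EuclideanSpace.single i (1 : ℝ)) ^ 2 := by positivity
    have hT : 0 ≤ (‖y - x‖ ^ 2 + d) ^ (-a / 2 - 1) := by positivity
    calc _ ≤ a * (a + 3) * (‖y - x‖ ^ 2 + d) ^ (-a / 2 - 1) := by
          simp only [PiLp.norm_single, norm_one, one_pow, mul_one]
          set S := (‖y - x‖ ^ 2 + d) ^ (-a / 2 - 2) *
            inner ℝ (y - x) (EuclideanSpace.single i (1 : ℝ)) ^ 2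
          set T := (‖y - x‖ ^ 2 + d) ^ (-a / 2 - 1)
          have : 2 * (-a / 2) * (2 * (-a / 2 - 1) * (‖y - x‖ ^ 2 + d) ^ (-a / 2 - 2) *
              inner ℝ (y - x) (EuclideanSpace.single i (1 : ℝ)) ^ 2 + T) =
              a * ((a + 2) * S - T) := by
            simp only [S]
            ring
          rw [this, abs_mul, abs_of_nonneg ha, mul_assoc]
          gcongr
          rw [abs_le]
          constructor <;> nlinarith
      _ = a * (a + 3) * (‖y - x‖ ^ 2 + d) ^ (-(a + 2) / 2) := by
          congr 2
          ring
      _ ≤ a * (a + 3) * (M ^ (a + 2) * (1 + ‖y‖) ^ (-(a + 2))) := by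
          gcongr
          exact hpow _ (by linarith) y
      _ = (a * (a + 3) * M ^ (a + 2)) * (1 + ‖y‖) ^ (-(a + 2)) := by ring
      _ ≤ _ := by
          gcongr
          exact (le_max_right _ _).trans (le_max_right _ _)

lemma vecLaplacian_norm_sub_sq_add_rpow {n : ℕ} (x : EuclideanSpace ℝ (Fin n)) {d : ℝ}
    (hd : 0 < d) (y : EuclideanSpace ℝ (Fin n)) :
    vecLaplacian (fun y => (‖y - x‖ ^ 2 + d) ^ (-((n : ℝ) - 2) / 2)) y =
      -(n * (n - 2) * (d * (‖y - x‖ ^ 2 + d) ^ (-((n : ℝ) + 2) / 2))) := by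
  have hQ : 0 < ‖y - x‖ ^ 2 + d := by positivity
  have hs : ∑ i : Fin n, inner ℝ (y - x) (EuclideanSpace.single i (1 : ℝ)) ^ 2 =
      ‖y - x‖ ^ 2 := by
    rw [EuclideanSpace.norm_sq_eq]
    simp [EuclideanSpace.inner_single_right]
  simp_rw [vecLaplacian, fderiv_fderiv_norm_sub_sq_add_rpow x hd]
  simp only [PiLp.norm_single, norm_one, one_pow, mul_one]
  rw [← Finset.mul_sum, Finset.sum_add_distrib, ← Finset.mul_sum, hs]
  have e : (‖y - x‖ ^ 2 + d) ^ (-((n : ℝ) - 2) / 2 - 1) =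
      (‖y - x‖ ^ 2 + d) * (‖y - x‖ ^ 2 + d) ^ (-((n : ℝ) + 2) / 2) := by
    nth_rewrite 2 [← Real.rpow_one (‖y - x‖ ^ 2 + d)]
    rw [← Real.rpow_add hQ]
    congr 1
    ring
  rw [e, show -((n : ℝ) - 2) / 2 - 2 = -((n : ℝ) + 2) / 2 by ring]
  simp
  ring

lemma integral_dilated_kernel_mul {n : ℕ} (w : EuclideanSpace ℝ (Fin n) → ℝ)
    (x : EuclideanSpace ℝ (Fin n)) {δ : ℝ} (hδ : 0 < δ) :
    ∫ y, δ ^ 2 * (‖y - x‖ ^ 2 + δ ^ 2) ^ (-((n : ℝ) + 2) / 2) * w y =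
      ∫ z, (‖z‖ ^ 2 + 1) ^ (-((n : ℝ) + 2) / 2) * w (x + δ • z) := by
  have h1 := integral_add_left_eq_self (μ := (volume : Measure (EuclideanSpace ℝ (Fin n))))
    (fun y => δ ^ 2 * (‖y - x‖ ^ 2 + δ ^ 2) ^ (-((n : ℝ) + 2) / 2) * w y) x
  have h2 := Measure.integral_comp_smul_of_nonneg
    (volume : Measure (EuclideanSpace ℝ (Fin n)))
    (fun y => δ ^ 2 * (‖x + y - x‖ ^ 2 + δ ^ 2) ^ (-((n : ℝ) + 2) / 2) * w (x + y)) δ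
    (hR := hδ.le)
  rw [← h1]
  rw [smul_eq_mul, finrank_euclideanSpace_fin, eq_inv_mul_iff_mul_eq₀ (by positivity)] at h2
  rw [← h2, ← integral_const_mul]
  congr 1
  ext z
  have e1 : ‖x + δ • z - x‖ ^ 2 + δ ^ 2 = δ ^ 2 * (‖z‖ ^ 2 + 1) := by
    rw [add_sub_cancel_left, norm_smul, Real.norm_of_nonneg hδ.le]
    ring
  have e2 : (δ ^ 2) ^ (-((n : ℝ) + 2) / 2) = (δ ^ n * δ ^ 2)⁻¹ := by
    rw [← pow_add, ← Real.rpow_natCast δ 2, ← Real.rpow_mul hδ.le, ← Real.rpow_natCast,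
      ← Real.rpow_neg hδ.le]
    congr 1
    push_cast
    ring
  rw [e1, Real.mul_rpow (by positivity) (by positivity), e2]
  field_simp

lemma integrable_norm_sq_add_one_rpow (n : ℕ) :
    Integrable (fun z : EuclideanSpace ℝ (Fin n) => (‖z‖ ^ 2 + 1) ^ (-((n : ℝ) + 2) / 2)) := by
  have := integrable_rpow_neg_one_add_norm_sq (E := EuclideanSpace ℝ (Fin n)) (μ := volume)
    (r := (n : ℝ) + 2) (by simp)
  simpa only [add_comm] using this

lemma integral_norm_sq_add_one_rpow_pos (n : ℕ) :
    0 < ∫ z : EuclideanSpace ℝ (Fin n), (‖z‖ ^ 2 + 1) ^ (-((n : ℝ) + 2) / 2) := by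
  refine (integral_pos_iff_support_of_nonneg (fun z => by positivity)
    (integrable_norm_sq_add_one_rpow n)).2 ?_
  have : Function.support (fun z : EuclideanSpace ℝ (Fin n) =>
      (‖z‖ ^ 2 + 1) ^ (-((n : ℝ) + 2) / 2)) = Set.univ := by
    ext z
    simp only [Function.mem_support, Set.mem_univ, iff_true]
    positivity
  rw [this]
  exact isOpen_univ.measure_pos _ Set.univ_nonempty

lemma tendsto_integral_dilated_kernel_mul {n : ℕ} {w : EuclideanSpace ℝ (Fin n) → ℝ}
    (hw : Continuous w) {M : ℝ} (hM : ∀ y, |w y| ≤ M) (x : EuclideanSpace ℝ (Fin n)) :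
    Tendsto (fun δ : ℝ => ∫ y, δ ^ 2 * (‖y - x‖ ^ 2 + δ ^ 2) ^ (-((n : ℝ) + 2) / 2) * w y)
      (𝓝[>] 0) (𝓝 ((∫ z : EuclideanSpace ℝ (Fin n),
        (‖z‖ ^ 2 + 1) ^ (-((n : ℝ) + 2) / 2)) * w x)) := by
  have hk : Continuous (fun z : EuclideanSpace ℝ (Fin n) =>
      (‖z‖ ^ 2 + 1) ^ (-((n : ℝ) + 2) / 2)) :=
    (by fun_prop : Continuous fun z : EuclideanSpace ℝ (Fin n) => ‖z‖ ^ 2 + 1).rpow_const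
      fun z => Or.inl (by positivity)
  have h : Tendsto (fun δ : ℝ => ∫ z : EuclideanSpace ℝ (Fin n),
      (‖z‖ ^ 2 + 1) ^ (-((n : ℝ) + 2) / 2) * w (x + δ • z)) (𝓝[>] 0)
      (𝓝 (∫ z : EuclideanSpace ℝ (Fin n), (‖z‖ ^ 2 + 1) ^ (-((n : ℝ) + 2) / 2) * w x)) := by
    refine tendsto_integral_filter_of_dominated_convergence
      (fun z => (‖z‖ ^ 2 + 1) ^ (-((n : ℝ) + 2) / 2) * M) ?_ ?_
      ((integrable_norm_sq_add_one_rpow n).mul_const M) ?_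
    · exact Eventually.of_forall fun δ =>
        (hk.mul (hw.comp (by fun_prop))).aestronglyMeasurable
    · refine Eventually.of_forall fun δ => Eventually.of_forall fun z => ?_
      rw [Real.norm_eq_abs, abs_mul, abs_of_nonneg (by positivity)]
      gcongr
      exact hM _
    · refine Eventually.of_forall fun z => ?_
      have hc : Continuous fun δ : ℝ =>
          (‖z‖ ^ 2 + 1) ^ (-((n : ℝ) + 2) / 2) * w (x + δ • z) :=
        continuous_const.mul (hw.comp (by fun_prop))
      have := hc.tendsto 0
      simp only [zero_smul, add_zero] at this
      exact this.mono_left nhdsWithin_le_nhds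
  rw [integral_mul_const] at h
  refine h.congr' ?_
  filter_upwards [self_mem_nhdsWithin] with δ hδ
  exact (integral_dilated_kernel_mul w x hδ).symm

lemma tendsto_integral_regularized_newton_mul {n : ℕ} {f : EuclideanSpace ℝ (Fin n) → ℝ}
    (hf : Continuous f) {ρ : ℝ} (hsupp : ∀ y, ρ < ‖y‖ → f y = 0) {p : ℝ} (hp : 0 ≤ p)
    {x : EuclideanSpace ℝ (Fin n)} (hx : ρ < ‖x‖) :
    Tendsto (fun δ : ℝ => ∫ y, (‖y - x‖ ^ 2 + δ ^ 2) ^ (-p) * f y)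
      (𝓝[>] 0) (𝓝 (∫ y, (‖y - x‖ ^ 2) ^ (-p) * f y)) := by
  have hfc : HasCompactSupport f :=
    HasCompactSupport.intro (isCompact_closedBall 0 ρ) fun y hy => hsupp y (by simpa using hy)
  have hpos : 0 < ‖x‖ - ρ := sub_pos.2 hx
  have hlow : ∀ y : EuclideanSpace ℝ (Fin n), ‖y‖ ≤ ρ → (‖x‖ - ρ) ^ 2 ≤ ‖y - x‖ ^ 2 := by
    intro y hy
    have := norm_sub_norm_le x y
    rw [norm_sub_rev] at this
    exact pow_le_pow_left₀ hpos.le (by linarith) 2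
  refine tendsto_integral_filter_of_dominated_convergence
    (fun y => ((‖x‖ - ρ) ^ 2) ^ (-p) * |f y|) ?_ ?_
    ((hf.integrable_of_hasCompactSupport hfc).abs.const_mul _) ?_
  · filter_upwards [self_mem_nhdsWithin] with δ hδ
    have hδ : 0 < δ := hδ
    exact (((by fun_prop : Continuous fun y => ‖y - x‖ ^ 2 + δ ^ 2).rpow_const
      fun z => Or.inl (by positivity)).mul hf).aestronglyMeasurable
  · filter_upwards [self_mem_nhdsWithin] with δ hδ
    refine Eventually.of_forall fun y => ?_
    rw [Real.norm_eq_abs, abs_mul, abs_of_nonneg (by positivity)]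
    by_cases hy : ‖y‖ ≤ ρ
    · gcongr ?_ * _
      exact Real.rpow_le_rpow_of_nonpos (by positivity)
        ((hlow y hy).trans (by nlinarith [sq_nonneg δ])) (by linarith)
    · simp [hsupp y (not_le.1 hy)]
  · refine Eventually.of_forall fun y => ?_
    by_cases hy : ‖y‖ ≤ ρ
    · have hne : ‖y - x‖ ^ 2 ≠ 0 := (lt_of_lt_of_le (by positivity) (hlow y hy)).ne'
      have hc : ContinuousAt (fun δ : ℝ => (‖y - x‖ ^ 2 + δ ^ 2) ^ (-p) * f y) 0 :=
        ContinuousAt.mul (ContinuousAt.rpow_const (by fun_prop) (Or.inl (by simpa using hne)))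
          continuousAt_const
      have := hc.tendsto
      simp only [ne_eq, OfNat.ofNat_ne_zero, not_false_eq_true, zero_pow, add_zero] at this
      exact this.mono_left nhdsWithin_le_nhds
    · simp [hsupp y (not_le.1 hy)]

lemma HasDecay.exists_abs_le {n : ℕ} (hn : 0 < n) {w : EuclideanSpace ℝ (Fin n) → ℝ} {b : ℝ}
    (hb : 0 ≤ b) (hw : HasDecay w b) : ∃ M, ∀ y, |w y| ≤ M := by
  obtain ⟨C, hC⟩ := hw.2 ⟨0, hn⟩
  refine ⟨C, fun y => (hC y).1.trans ?_⟩
  have hC0 : 0 ≤ C := by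
    have := (abs_nonneg _).trans (hC 0).1
    simpa using this
  refine mul_le_of_le_one_right hC0 (Real.rpow_le_one_of_one_le_of_nonpos ?_ (by linarith))
  linarith [norm_nonneg y]

lemma ContDiff.continuous_vecLaplacian_s11 {n : ℕ} {w : EuclideanSpace ℝ (Fin n) → ℝ}
    (hw : ContDiff ℝ 2 w) : Continuous (vecLaplacian w) := by
  unfold vecLaplacian
  exact continuous_finsetSum _ fun i _ => hw.continuous_fderiv_fderiv_apply _

/-- Newtonian potential representation of a decaying function whose Laplacian is supported in a
ball, outside of that ball. -/
lemma newton_representation {n : ℕ} (hn : 3 ≤ n) {w : EuclideanSpace ℝ (Fin n) → ℝ}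
    (hw : HasDecay w ((n : ℝ) - 1)) {ρ : ℝ} (hsupp : ∀ y, ρ < ‖y‖ → vecLaplacian w y = 0) :
    ∃ c : ℝ, ∀ x, ρ < ‖x‖ →
      w x = c * ∫ y, (‖y - x‖ ^ 2) ^ (-(((n : ℝ) - 2) / 2)) * vecLaplacian w y := by
  have hn' : (3 : ℝ) ≤ n := by exact_mod_cast hn
  obtain ⟨M, hM⟩ := hw.exists_abs_le (by omega) (by linarith)
  have hκ := integral_norm_sq_add_one_rpow_pos n
  set κ := ∫ z : EuclideanSpace ℝ (Fin n), (‖z‖ ^ 2 + 1) ^ (-((n : ℝ) + 2) / 2)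
  refine ⟨-(n * (n - 2) * κ)⁻¹, fun x hx => ?_⟩
  have h1 := (tendsto_integral_dilated_kernel_mul hw.1.continuous hM x).const_mul
    (-((n : ℝ) * (n - 2)))
  have h2 := tendsto_integral_regularized_newton_mul hw.1.continuous_vecLaplacian_s11 hsupp
    (p := ((n : ℝ) - 2) / 2) (by linarith) hx
  have h3 : -((n : ℝ) * (n - 2)) * (κ * w x) =
      ∫ y, (‖y - x‖ ^ 2) ^ (-(((n : ℝ) - 2) / 2)) * vecLaplacian w y := by
    refine tendsto_nhds_unique (h1.congr' ?_) h2
    filter_upwards [self_mem_nhdsWithin] with δ hδ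
    have hδ : 0 < δ := hδ
    have hG := integral_mul_vecLaplacian (by linarith)
      (hasDecay_norm_sub_sq_add_rpow x (d := δ ^ 2) (by positivity)
        (a := (n : ℝ) - 2) (by linarith)) hw
    simp_rw [vecLaplacian_norm_sub_sq_add_rpow x (show 0 < δ ^ 2 by positivity)] at hG
    rw [← integral_const_mul]
    simp_rw [← neg_div]
    rw [hG]
    congr 1
    ext y
    ring
  rw [← h3]
  have : (n : ℝ) - 2 ≠ 0 := by linarith
  have : (n : ℝ) ≠ 0 := by linarith
  field_simp

lemma exists_one_add_rpow_taylor_bound (a : ℝ) :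
    ∃ C > 0, ∃ η > 0, ∀ s : ℝ, |s| < η → |(1 + s) ^ a - 1 - a * s| ≤ C * s ^ 2 := by
  have h := (Real.one_add_rpow_hasFPowerSeriesAt_zero (a := a)).isBigO_sub_partialSum_pow 2
  obtain ⟨C, hC, h⟩ := h.exists_pos
  rw [Asymptotics.isBigOWith_iff, Metric.eventually_nhds_iff] at h
  obtain ⟨η, hη, h⟩ := h
  refine ⟨C, hC, η, hη, fun s hs => ?_⟩
  rw [sub_sub, mul_comm a s]
  simpa [FormalMultilinearSeries.partialSum, Finset.sum_range_succ, binomialSeries] using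
    h (y := s) (by simpa using hs)

lemma exists_newton_kernel_expansion {E : Type*} [NormedAddCommGroup E] [InnerProductSpace ℝ E]
    {p : ℝ} (hp : 0 ≤ p) {ρ : ℝ} (hρ : 0 < ρ) :
    ∃ C > 0, ∃ R₁ > 0, ∀ x y : E, R₁ ≤ ‖x‖ → ‖y‖ ≤ ρ →
      |(‖y - x‖ ^ 2) ^ (-p) - (‖x‖ ^ (-(2 * p)) + 2 * p * inner ℝ x y * ‖x‖ ^ (-(2 * p + 2)))|
        ≤ C * ‖x‖ ^ (-(2 * p + 2)) := by
  obtain ⟨C, hC, η, hη, h⟩ := exists_one_add_rpow_taylor_bound (-p)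
  set M := ρ ^ 2 + 2 * ρ with hM
  have hMpos : 0 < M := by positivity
  refine ⟨C * M ^ 2 + p * ρ ^ 2, by positivity, max 1 (2 * M / η), by positivity,
    fun x y hx hy => ?_⟩
  have hx1 : 1 ≤ ‖x‖ := (le_max_left _ _).trans hx
  have hx2 : 2 * M / η ≤ ‖x‖ := (le_max_right _ _).trans hx
  have hx0 : 0 < ‖x‖ := by linarith
  set s := (‖y‖ ^ 2 - 2 * inner ℝ x y) / ‖x‖ ^ 2 with hs
  have hin : |inner ℝ x y| ≤ ‖x‖ * ρ :=
    (abs_real_inner_le_norm x y).trans (by gcongr)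
  have hyy : ‖y‖ ^ 2 ≤ ρ ^ 2 := pow_le_pow_left₀ (norm_nonneg _) hy 2
  have hsM : |s| ≤ M / ‖x‖ := by
    rw [hs, abs_div, abs_of_nonneg (sq_nonneg ‖x‖), div_le_div_iff₀ (by positivity) hx0]
    have : |‖y‖ ^ 2 - 2 * inner ℝ x y| ≤ ρ ^ 2 + 2 * (‖x‖ * ρ) := by
      rw [abs_le] at hin ⊢
      constructor <;> nlinarith [sq_nonneg ‖y‖]
    have h2 : ρ ^ 2 + 2 * (‖x‖ * ρ) ≤ M * ‖x‖ := by
      rw [hM]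
      nlinarith [sq_nonneg ρ]
    calc _ ≤ (M * ‖x‖) * ‖x‖ := by gcongr; exact this.trans h2
      _ = _ := by ring
  have hsη : |s| < η := by
    refine hsM.trans_lt ?_
    rw [div_lt_iff₀ hx0]
    rw [div_le_iff₀ hη] at hx2
    linarith
  have hT := h s hsη
  have hs2 : s ^ 2 ≤ M ^ 2 / ‖x‖ ^ 2 := by
    rw [← sq_abs, ← div_pow]
    exact pow_le_pow_left₀ (abs_nonneg _) hsM 2
  have e1 : ‖y - x‖ ^ 2 = ‖x‖ ^ 2 * (1 + s) := by
    rw [@norm_sub_sq_real, hs, real_inner_comm]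
    field_simp
    ring
  have h1s : 0 ≤ 1 + s := by
    by_contra hcon
    have : ‖x‖ ^ 2 * (1 + s) < 0 := mul_neg_of_pos_of_neg (by positivity) (by linarith)
    linarith [sq_nonneg ‖y - x‖]
  have e2 : (‖x‖ ^ 2) ^ (-p) = ‖x‖ ^ (-(2 * p)) := by
    rw [← Real.rpow_natCast ‖x‖ 2, ← Real.rpow_mul hx0.le]
    congr 1
    push_cast
    ring
  have e3 : ‖x‖ ^ (-(2 * p + 2)) = ‖x‖ ^ (-(2 * p)) / ‖x‖ ^ 2 := by
    rw [neg_add, Real.rpow_add hx0, Real.rpow_neg hx0.le 2, ← Real.rpow_natCast ‖x‖ 2]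
    rfl
  rw [e1, Real.mul_rpow (by positivity) h1s, e2, e3]
  have e4 : ‖x‖ ^ (-(2 * p)) * (1 + s) ^ (-p) - (‖x‖ ^ (-(2 * p)) +
      2 * p * inner ℝ x y * (‖x‖ ^ (-(2 * p)) / ‖x‖ ^ 2)) =
      ‖x‖ ^ (-(2 * p)) * (((1 + s) ^ (-p) - 1 - -p * s) - p * (‖y‖ ^ 2 / ‖x‖ ^ 2)) := by
    rw [hs]
    field_simp
    ring
  rw [e4, abs_mul, abs_of_nonneg (by positivity)]
  calc _ ≤ ‖x‖ ^ (-(2 * p)) * (C * (M ^ 2 / ‖x‖ ^ 2) + p * (ρ ^ 2 / ‖x‖ ^ 2)) := by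
        gcongr
        refine (abs_sub _ _).trans (add_le_add (hT.trans (by gcongr)) ?_)
        rw [abs_of_nonneg (by positivity)]
        gcongr
    _ = _ := by ring

/-- Far field expansion of a Newtonian potential up to the dipole term. -/
lemma exists_newton_potential_expansion {n : ℕ} {f : EuclideanSpace ℝ (Fin n) → ℝ}
    (hf : Continuous f) {ρ : ℝ} (hρ : 0 < ρ) (hsupp : ∀ y, ρ < ‖y‖ → f y = 0)
    {p : ℝ} (hp : 0 ≤ p) :
    ∃ (A : ℝ) (b : EuclideanSpace ℝ (Fin n)), ∃ C > 0, ∃ R₁ > 0,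
      ∀ x : EuclideanSpace ℝ (Fin n), R₁ ≤ ‖x‖ →
      |(∫ y, (‖y - x‖ ^ 2) ^ (-p) * f y) -
        (A * ‖x‖ ^ (-(2 * p)) + inner ℝ b x * ‖x‖ ^ (-(2 * p + 2)))| ≤
        C * ‖x‖ ^ (-(2 * p + 2)) := by
  obtain ⟨C, hC, R₁, hR₁, h⟩ :=
    exists_newton_kernel_expansion (E := EuclideanSpace ℝ (Fin n)) hp hρ
  have hfc : HasCompactSupport f :=
    HasCompactSupport.intro (isCompact_closedBall 0 ρ) fun y hy => hsupp y (by simpa using hy)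
  have hfi := hf.integrable_of_hasCompactSupport (μ := volume) hfc
  have hfy : Integrable (fun y => f y • y) :=
    (hf.smul continuous_id).integrable_of_hasCompactSupport hfc.smul_right
  refine ⟨∫ y, f y, (2 * p) • ∫ y, f y • y, C * (∫ y, |f y|) + 1, ?_, max R₁ (ρ + 1), ?_,
    fun x hx => ?_⟩
  · have : 0 ≤ ∫ y, |f y| := integral_nonneg fun y => abs_nonneg _
    positivity
  · positivity
  have hx1 : R₁ ≤ ‖x‖ := (le_max_left _ _).trans hx
  have hx2 : ρ + 1 ≤ ‖x‖ := (le_max_right _ _).trans hx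
  have hi : Integrable (fun y => (‖x‖ ^ (-(2 * p)) + 2 * p * inner ℝ x y *
      ‖x‖ ^ (-(2 * p + 2))) * f y) :=
    (Continuous.mul (by fun_prop) hf).integrable_of_hasCompactSupport hfc.mul_left
  have e : (∫ y, f y) * ‖x‖ ^ (-(2 * p)) + inner ℝ ((2 * p) • ∫ y, f y • y) x *
      ‖x‖ ^ (-(2 * p + 2)) = ∫ y, (‖x‖ ^ (-(2 * p)) + 2 * p * inner ℝ x y *
      ‖x‖ ^ (-(2 * p + 2))) * f y := by
    rw [real_inner_smul_left, real_inner_comm, ← integral_inner hfy, ← integral_mul_const,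
      ← integral_const_mul, ← integral_mul_const, ← integral_add]
    · congr 1
      ext y
      rw [real_inner_smul_right]
      ring
    · exact hfi.mul_const _
    · exact (((hfy.const_inner x)).const_mul _).mul_const _
  have hbound : ∀ y, ‖(‖y - x‖ ^ 2) ^ (-p) * f y - (‖x‖ ^ (-(2 * p)) + 2 * p * inner ℝ x y *
      ‖x‖ ^ (-(2 * p + 2))) * f y‖ ≤ C * ‖x‖ ^ (-(2 * p + 2)) * |f y| := by
    intro y
    rw [← sub_mul, norm_mul, Real.norm_eq_abs, Real.norm_eq_abs]
    by_cases hy : ‖y‖ ≤ ρ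
    · gcongr
      exact h x y hx1 hy
    · simp [hsupp y (not_le.1 hy)]
  have hmeas : AEStronglyMeasurable (fun y => (‖y - x‖ ^ 2) ^ (-p) * f y) volume := by
    refine AEStronglyMeasurable.mul (Measurable.aestronglyMeasurable ?_) hf.aestronglyMeasurable
    fun_prop
  have hdi : Integrable (fun y => (‖y - x‖ ^ 2) ^ (-p) * f y - (‖x‖ ^ (-(2 * p)) +
      2 * p * inner ℝ x y * ‖x‖ ^ (-(2 * p + 2))) * f y) :=
    (hfi.abs.const_mul _).mono' (hmeas.sub hi.aestronglyMeasurable)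
      (Eventually.of_forall hbound)
  have hki : Integrable (fun y => (‖y - x‖ ^ 2) ^ (-p) * f y) :=
    (hdi.add hi).congr (Eventually.of_forall fun y => by simp)
  rw [e, ← integral_sub hki hi]
  refine (norm_integral_le_of_norm_le (hfi.abs.const_mul _)
    (Eventually.of_forall hbound)).trans ?_
  rw [integral_const_mul]
  have : 0 ≤ ‖x‖ ^ (-(2 * p + 2)) := by positivity
  nlinarith

lemma exists_global_decay_bound {E : Type*} [NormedAddCommGroup E] [ProperSpace E]
    {F : E → ℝ} (hF : Continuous F) {a C R₀ : ℝ} (ha : 0 ≤ a) (hC : 0 ≤ C)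
    (h : ∀ x, R₀ ≤ ‖x‖ → |F x| ≤ C * ‖x‖ ^ (-a)) :
    ∃ C', ∀ x, |F x| ≤ C' * (1 + ‖x‖) ^ (-a) := by
  obtain ⟨M, hM⟩ := (isCompact_closedBall (0 : E) (max R₀ 1)).exists_bound_of_continuousOn
    (f := fun x => F x * (1 + ‖x‖) ^ a)
    ((hF.mul ((by fun_prop : Continuous fun x : E => 1 + ‖x‖).rpow_const
      fun x => Or.inr ha)).continuousOn)
  refine ⟨max M (C * 2 ^ a), fun x => ?_⟩
  have hx : 0 < 1 + ‖x‖ := by positivity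
  rw [Real.rpow_neg hx.le, ← div_eq_mul_inv, le_div_iff₀ (by positivity)]
  by_cases hxR : ‖x‖ ≤ max R₀ 1
  · have := hM x (by simpa using hxR)
    rw [norm_mul, Real.norm_eq_abs, Real.norm_of_nonneg (by positivity)] at this
    exact this.trans (le_max_left _ _)
  · rw [not_le, max_lt_iff] at hxR
    refine le_trans ?_ (le_max_right _ _)
    have hx0 : 0 < ‖x‖ := by linarith
    calc |F x| * (1 + ‖x‖) ^ a ≤ (C * ‖x‖ ^ (-a)) * (2 * ‖x‖) ^ a := by
          gcongr
          · exact h x hxR.1.le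
          · linarith
      _ = C * 2 ^ a := by
          rw [Real.mul_rpow (by norm_num) hx0.le, Real.rpow_neg hx0.le]
          field_simp

lemma isOpen_setOf_lt_norm {E : Type*} [NormedAddCommGroup E] (R : ℝ) :
    IsOpen {x : E | R < ‖x‖} :=
  isOpen_lt continuous_const continuous_norm

lemma BigOInfty.exists_partialDeriv_bounds {n : ℕ} {u : EuclideanSpace ℝ (Fin n) → ℝ} {R a : ℝ}
    (hu : ContDiffOn ℝ (⊤ : ℕ∞) u {x | R < ‖x‖}) (hO : BigOInfty u R (-a)) :
    ∃ C > 0, ∃ R₀ > R, ∀ x, R₀ ≤ ‖x‖ → |u x| ≤ C * ‖x‖ ^ (-a) ∧ ∀ i : Fin n,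
      |fderiv ℝ u x (EuclideanSpace.single i 1)| ≤ C * ‖x‖ ^ (-(a + 1)) ∧
      |fderiv ℝ (fun z => fderiv ℝ u z (EuclideanSpace.single i 1)) x
        (EuclideanSpace.single i 1)| ≤ C * ‖x‖ ^ (-(a + 2)) := by
  obtain ⟨C0, hC0, R0, hR0, h0⟩ := hO 0
  obtain ⟨C1, hC1, R1, hR1, h1⟩ := hO 1
  obtain ⟨C2, hC2, R2, hR2, h2⟩ := hO 2
  refine ⟨max C0 (max C1 C2), by positivity, max (R + 1) (max R0 (max R1 R2)),
    lt_of_lt_of_le (by linarith) (le_max_left _ _), fun x hx => ?_⟩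
  simp only [max_le_iff] at hx
  obtain ⟨hxR, hx0, hx1, hx2⟩ := hx
  have hcd : ContDiffAt ℝ (⊤ : ℕ∞) u x :=
    hu.contDiffAt ((isOpen_setOf_lt_norm R).mem_nhds (show R < ‖x‖ by linarith))
  have h0 := h0 x hx0
  have h1 := h1 x hx1
  have h2 := h2 x hx2
  rw [norm_iteratedFDeriv_zero, Real.norm_eq_abs] at h0
  rw [norm_iteratedFDeriv_one] at h1
  have n1 : ∀ i : Fin n, ‖EuclideanSpace.single i (1 : ℝ)‖ = 1 := fun i => by simp
  refine ⟨?_, fun i => ⟨?_, ?_⟩⟩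
  · simp only [Nat.cast_zero, sub_zero] at h0
    exact h0.trans (by gcongr; exact le_max_left _ _)
  · refine ((fderiv ℝ u x).le_opNorm _).trans ?_
    rw [n1, mul_one]
    refine h1.trans ?_
    rw [show -a - ((1 : ℕ) : ℝ) = -(a + 1) by push_cast; ring]
    gcongr
    exact (le_max_left _ _).trans (le_max_right _ _)
  · have hd : DifferentiableAt ℝ (fderiv ℝ u) x :=
      ((hcd.of_le (m := 2) (WithTop.coe_le_coe.2 le_top)).fderiv_right (m := 1)
        (by norm_num)).differentiableAt (by norm_num)
    have e : fderiv ℝ (fun z => fderiv ℝ u z (EuclideanSpace.single i 1)) x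
        (EuclideanSpace.single i 1) =
        iteratedFDeriv ℝ 2 u x (fun _ => EuclideanSpace.single i 1) := by
      rw [iteratedFDeriv_two_apply, fderiv_clm_apply hd (differentiableAt_const _)]
      simp
    rw [e, ← Real.norm_eq_abs]
    refine ((iteratedFDeriv ℝ 2 u x).le_opNorm _).trans ?_
    simp only [n1, Finset.prod_const_one, mul_one]
    refine h2.trans ?_
    rw [show -a - ((2 : ℕ) : ℝ) = -(a + 2) by push_cast; ring]
    gcongr
    exact (le_max_right _ _).trans (le_max_right _ _)

/-- A decaying function on an exterior domain, harmonic there, agrees near infinity with a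
decaying function on all of space whose Laplacian is compactly supported. -/
lemma exists_global_extension {n : ℕ} {u : EuclideanSpace ℝ (Fin n) → ℝ} {R a : ℝ}
    (hR : 0 < R) (ha : 0 ≤ a) (hu : IsHarmonicOn u {x | R < ‖x‖})
    (hO : BigOInfty u R (-a)) :
    ∃ w : EuclideanSpace ℝ (Fin n) → ℝ, HasDecay w a ∧
      (∀ x, R + 2 < ‖x‖ → vecLaplacian w x = 0) ∧ ∀ x, R + 2 < ‖x‖ → w x = u x := by
  let χ : ContDiffBump (0 : EuclideanSpace ℝ (Fin n)) :=
    ⟨R + 1, R + 2, by linarith, by linarith⟩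
  let w : EuclideanSpace ℝ (Fin n) → ℝ := fun x => (1 - χ x) * u x
  have hwu : ∀ x, R + 2 < ‖x‖ → w =ᶠ[𝓝 x] u := by
    intro x hx
    filter_upwards [(isOpen_setOf_lt_norm (R + 2)).mem_nhds hx] with y hy
    have : χ y = 0 := χ.zero_of_le_dist (by simpa using le_of_lt hy)
    simp [w, this]
  have hw : ContDiff ℝ 2 w := by
    rw [contDiff_iff_contDiffAt]
    intro x
    by_cases hx : R < ‖x‖
    · have := hu.1.contDiffAt ((isOpen_setOf_lt_norm R).mem_nhds hx)
      exact (contDiffAt_const.sub χ.contDiffAt).mul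
        (this.of_le (m := 2) (WithTop.coe_le_coe.2 le_top))
    · have h1 : w =ᶠ[𝓝 x] fun _ => 0 := by
        have hxm : x ∈ Metric.ball (0 : EuclideanSpace ℝ (Fin n)) χ.rIn := by
          simp only [Metric.mem_ball, dist_zero_right, χ]
          linarith
        filter_upwards [χ.eventuallyEq_one_of_mem_ball hxm] with y hy
        simp [w, hy]
      exact contDiffAt_const.congr_of_eventuallyEq h1
  have hwf : ∀ x, R + 2 < ‖x‖ → fderiv ℝ w =ᶠ[𝓝 x] fderiv ℝ u := fun x hx => (hwu x hx).fderiv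
  have hwff : ∀ x, R + 2 < ‖x‖ → ∀ v, fderiv ℝ (fun z => fderiv ℝ w z v) x =
      fderiv ℝ (fun z => fderiv ℝ u z v) x := fun x hx v =>
    Filter.EventuallyEq.fderiv_eq ((hwf x hx).mono fun y hy => by simp [hy])
  refine ⟨w, ⟨hw, fun i => ?_⟩, fun x hx => ?_, fun x hx => (hwu x hx).eq_of_nhds⟩
  · obtain ⟨C, hC, R₀, -, h⟩ := hO.exists_partialDeriv_bounds hu.1
    have far : ∀ x : EuclideanSpace ℝ (Fin n), max (R + 3) R₀ ≤ ‖x‖ →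
        R + 2 < ‖x‖ ∧ R₀ ≤ ‖x‖ := fun x hx =>
      ⟨by linarith [(le_max_left _ _).trans hx], (le_max_right _ _).trans hx⟩
    obtain ⟨D0, h0⟩ := exists_global_decay_bound (R₀ := max (R + 3) R₀) hw.continuous ha hC.le
      fun x hx => by
        rw [(hwu x (far x hx).1).eq_of_nhds]
        exact (h x (far x hx).2).1
    obtain ⟨D1, h1⟩ := exists_global_decay_bound (R₀ := max (R + 3) R₀)
      (hw.fderiv_apply_const (EuclideanSpace.single i 1)).continuous
      (by linarith : 0 ≤ a + 1) hC.le fun x hx => by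
        rw [(hwf x (far x hx).1).eq_of_nhds]
        exact ((h x (far x hx).2).2 i).1
    obtain ⟨D2, h2⟩ := exists_global_decay_bound (R₀ := max (R + 3) R₀)
      (hw.continuous_fderiv_fderiv_apply (EuclideanSpace.single i 1))
      (by linarith : 0 ≤ a + 2) hC.le fun x hx => by
        rw [hwff x (far x hx).1]
        exact ((h x (far x hx).2).2 i).2
    refine ⟨max D0 (max D1 D2), fun y => ⟨(h0 y).trans ?_, (h1 y).trans ?_, (h2 y).trans ?_⟩⟩
    · gcongr
      exact le_max_left _ _
    · gcongr
      exact (le_max_left _ _).trans (le_max_right _ _)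
    · gcongr
      exact (le_max_right _ _).trans (le_max_right _ _)
  · have := hu.2 x (show R < ‖x‖ by linarith)
    rw [vecLaplacian] at this ⊢
    simp_rw [hwff x hx]
    exact this

/-- An exterior harmonic function of order `r^{1-n}` is a dipole potential up to `O(r^{-n})`. -/
lemma IsHarmonicOn.exists_dipole_expansion {n : ℕ} (hn : 3 ≤ n)
    {u : EuclideanSpace ℝ (Fin n) → ℝ} {R : ℝ} (hR : 0 < R)
    (hu : IsHarmonicOn u {x | R < ‖x‖}) (hO : BigOInfty u R (1 - (n : ℝ))) :
    ∃ b : EuclideanSpace ℝ (Fin n), ∃ C > 0, ∃ R₁ > 0, ∀ x : EuclideanSpace ℝ (Fin n),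
      R₁ ≤ ‖x‖ → |u x - inner ℝ b x * ‖x‖ ^ (-(n : ℝ))| ≤ C * ‖x‖ ^ (-(n : ℝ)) := by
  have hn' : (3 : ℝ) ≤ n := by exact_mod_cast hn
  rw [← neg_sub] at hO
  obtain ⟨D, hD, R₂, hR₂, hub⟩ := hO.exists_partialDeriv_bounds hu.1
  obtain ⟨w, hw, hsupp, hwu⟩ := exists_global_extension hR (by linarith) hu hO
  obtain ⟨c, hc⟩ := newton_representation hn hw hsupp
  obtain ⟨A, b, C, hC, R₁, hR₁, h⟩ := exists_newton_potential_expansion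
    hw.1.continuous_vecLaplacian_s11 (by linarith : 0 < R + 2) hsupp
    (p := ((n : ℝ) - 2) / 2) (by linarith)
  rw [show 2 * (((n : ℝ) - 2) / 2) = n - 2 by ring, show (n : ℝ) - 2 + 2 = n by ring] at h
  have hexp : ∀ x : EuclideanSpace ℝ (Fin n), max R₁ (R + 3) ≤ ‖x‖ →
      |u x - (c * A * ‖x‖ ^ (-((n : ℝ) - 2)) + inner ℝ (c • b) x * ‖x‖ ^ (-(n : ℝ)))| ≤
        (|c| * C + 1) * ‖x‖ ^ (-(n : ℝ)) := by
    intro x hx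
    have hx1 := (le_max_left _ _).trans hx
    have hx2 : R + 2 < ‖x‖ := by linarith [(le_max_right _ _).trans hx]
    rw [← hwu x hx2, hc x hx2, real_inner_smul_left, mul_assoc c, mul_assoc c, ← mul_add,
      ← mul_sub, abs_mul]
    have h1 := mul_le_mul_of_nonneg_left (h x hx1) (abs_nonneg c)
    have h2 : 0 ≤ ‖x‖ ^ (-(n : ℝ)) := by positivity
    linarith
  have hA : c * A = 0 := by
    by_contra hne
    have hpos : 0 < |c * A| := abs_pos.2 hne
    set K := D + ‖c • b‖ + (|c| * C + 1)
    have hK : 0 < K := by positivity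
    set r := max (max R₁ (R + 3)) (max R₂ (K / |c * A| + 1)) with hr
    have hr3 : R + 3 ≤ r := (le_max_right _ _).trans (le_max_left _ _)
    have hr0 : 0 < r := by linarith
    let x : EuclideanSpace ℝ (Fin n) := EuclideanSpace.single ⟨0, by omega⟩ r
    have hx : ‖x‖ = r := by simp [x, abs_of_pos hr0]
    have h1 := hexp x (by rw [hx]; exact le_max_left _ _)
    have h2 := (hub x (by rw [hx]; exact (le_max_left _ _).trans (le_max_right _ _))).1
    have h3 : |inner ℝ (c • b) x| ≤ ‖c • b‖ * r := by
      simpa only [hx] using abs_real_inner_le_norm (c • b) x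
    rw [hx] at h1 h2
    have e1 : r ^ (-((n : ℝ) - 2)) = r ^ 2 * r ^ (-(n : ℝ)) := by
      rw [← Real.rpow_natCast r 2, ← Real.rpow_add hr0]
      congr 1
      push_cast
      ring
    have e2 : r ^ (-((n : ℝ) - 1)) = r * r ^ (-(n : ℝ)) := by
      nth_rewrite 2 [← Real.rpow_one r]
      rw [← Real.rpow_add hr0]
      congr 1
      ring
    rw [e1] at h1
    rw [e2] at h2
    have hN : 0 < r ^ (-(n : ℝ)) := by positivity
    set N := r ^ (-(n : ℝ))
    have h4 : |c * A| * (r ^ 2 * N) ≤ D * (r * N) + ‖c • b‖ * r * N + (|c| * C + 1) * N := by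
      have e : c * A * (r ^ 2 * N) = u x - inner ℝ (c • b) x * N -
          (u x - (c * A * (r ^ 2 * N) + inner ℝ (c • b) x * N)) := by ring
      calc |c * A| * (r ^ 2 * N) = |c * A * (r ^ 2 * N)| := by
            rw [abs_mul (c * A), abs_of_nonneg (by positivity : 0 ≤ r ^ 2 * N)]
        _ ≤ |u x - inner ℝ (c • b) x * N| + _ := by rw [e]; exact abs_sub _ _
        _ ≤ (|u x| + |inner ℝ (c • b) x * N|) + _ := by gcongr; exact abs_sub _ _
        _ ≤ _ := by
            rw [abs_mul _ N, abs_of_pos hN]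
            gcongr
    have h5 : |c * A| * r ≤ K := by
      have hr1 : 1 ≤ r := by linarith
      have : (|c * A| * r) * (r * N) ≤ K * (r * N) := by
        have h6 : (|c| * C + 1) * N ≤ (|c| * C + 1) * (r * N) := by
          gcongr
          nlinarith
        simp only [K]
        nlinarith
      exact le_of_mul_le_mul_right this (by positivity)
    have h6 : K / |c * A| + 1 ≤ r := (le_max_right _ _).trans (le_max_right _ _)
    have h7 : K < |c * A| * r := by
      calc K = |c * A| * (K / |c * A|) := by field_simp
        _ < |c * A| * r := by gcongr; linarith
    linarith
  refine ⟨c • b, |c| * C + 1, by positivity, max R₁ (R + 3), by positivity, fun x hx => ?_⟩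
  simpa [hA] using hexp x hx

/-- First order Taylor estimate along a segment. -/
lemma abs_sub_sub_fderiv_le {E : Type*} [NormedAddCommGroup E] [NormedSpace ℝ E]
    {g : E → ℝ} {x v : E} {h M : ℝ} (hh : 0 ≤ h)
    (hg : ∀ s ∈ Set.Icc 0 h, ContDiffAt ℝ 2 g (x + s • v))
    (hM : ∀ s ∈ Set.Icc 0 h, |fderiv ℝ (fun z => fderiv ℝ g z v) (x + s • v) v| ≤ M) :
    |g (x + h • v) - g x - h * fderiv ℝ g x v| ≤ M * h ^ 2 := by
  have hline : ∀ s : ℝ, HasDerivAt (fun s : ℝ => x + s • v) v s := fun s => by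
    simpa using ((hasDerivAt_id s).smul_const v).const_add x
  have hM0 : 0 ≤ M := (abs_nonneg _).trans (hM 0 ⟨le_rfl, hh⟩)
  have h1 : ∀ s ∈ Set.Icc 0 h, HasDerivWithinAt (fun s : ℝ => fderiv ℝ g (x + s • v) v)
      (fderiv ℝ (fun z => fderiv ℝ g z v) (x + s • v) v) (Set.Icc 0 h) s := by
    intro s hs
    have hd : DifferentiableAt ℝ (fun z => fderiv ℝ g z v) (x + s • v) :=
      (((hg s hs).fderiv_right (m := 1) (by norm_num)).differentiableAt
        (by norm_num)).clm_apply (differentiableAt_const _)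
    exact (hd.hasFDerivAt.comp_hasDerivAt s (hline s)).hasDerivWithinAt
  have h2 : ∀ s ∈ Set.Icc 0 h, |fderiv ℝ g (x + s • v) v - fderiv ℝ g x v| ≤ M * h := by
    intro s hs
    have := (convex_Icc 0 h).norm_image_sub_le_of_norm_hasDerivWithin_le h1 hM
      (Set.left_mem_Icc.2 hh) hs
    simp only [zero_smul, add_zero, sub_zero, Real.norm_eq_abs, abs_of_nonneg hs.1] at this
    exact this.trans (mul_le_mul_of_nonneg_left hs.2 hM0)
  have h3 : ∀ s ∈ Set.Icc 0 h, HasDerivWithinAt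
      (fun s : ℝ => g (x + s • v) - s * fderiv ℝ g x v)
      (fderiv ℝ g (x + s • v) v - fderiv ℝ g x v) (Set.Icc 0 h) s := by
    intro s hs
    have hd := ((hg s hs).differentiableAt (by norm_num)).hasFDerivAt.comp_hasDerivAt s (hline s)
    exact ((hd.sub ((hasDerivAt_id s).mul_const _)).congr_deriv
      (by rw [one_mul])).hasDerivWithinAt
  have h4 := (convex_Icc 0 h).norm_image_sub_le_of_norm_hasDerivWithin_le h3 h2
    (Set.left_mem_Icc.2 hh) (Set.right_mem_Icc.2 hh)
  simp only [zero_smul, add_zero, sub_zero, zero_mul, Real.norm_eq_abs, abs_of_nonneg hh] at h4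
  rw [show g (x + h • v) - g x - h * fderiv ℝ g x v =
    g (x + h • v) - h * fderiv ℝ g x v - g x by ring]
  calc _ ≤ M * h * h := h4
    _ = _ := by ring

lemma hasDerivAt_dipole {E : Type*} [NormedAddCommGroup E] [InnerProductSpace ℝ E]
    (b v : E) {x : E} (hx : x ≠ 0) (ν : ℝ) :
    HasDerivAt (fun t : ℝ => inner ℝ b (x + t • v) * ‖x + t • v‖ ^ (-ν))
      (‖x‖ ^ (-ν) * (inner ℝ b v - ν * inner ℝ b x * inner ℝ x v / ‖x‖ ^ 2)) 0 := by
  have hx0 : 0 < ‖x‖ := norm_pos_iff.2 hx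
  have hline : HasDerivAt (fun s : ℝ => x + s • v) v 0 := by
    simpa using ((hasDerivAt_id (0 : ℝ)).smul_const v).const_add x
  have h1 : HasDerivAt (fun t : ℝ => inner ℝ b (x + t • v)) (inner ℝ b v) 0 :=
    (innerSL ℝ b).hasFDerivAt.comp_hasDerivAt 0 hline
  have h2 : HasDerivAt (fun t : ℝ => ‖x + t • v‖ ^ 2) (2 * inner ℝ x v) 0 := by
    simpa using hline.norm_sq
  have h3 := h2.rpow_const (p := -ν / 2) (Or.inl (by simpa using hx))
  have e : ∀ y : E, (‖y‖ ^ 2) ^ (-ν / 2) = ‖y‖ ^ (-ν) := fun y => by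
    rw [← Real.rpow_natCast ‖y‖ 2, ← Real.rpow_mul (norm_nonneg y)]
    congr 1
    push_cast
    ring
  simp_rw [e] at h3
  refine (h1.mul h3).congr_deriv ?_
  have e2 : (‖x‖ ^ 2) ^ (-ν / 2 - 1) = ‖x‖ ^ (-ν) / ‖x‖ ^ 2 := by
    rw [Real.rpow_sub_one (by positivity), e]
  simp only [zero_smul, add_zero, e2]
  field_simp
  ring

/-- If `g` is a dipole potential up to `O(r^{-ν})` and its second derivatives in direction `v`
are `O(r^{-ν-1})`, then the derivative of `g` in direction `v` has the derivative of the dipole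
potential as its rescaled limit. -/
lemma tendsto_rpow_mul_fderiv_of_dipole {E : Type*} [NormedAddCommGroup E]
    [InnerProductSpace ℝ E] {g : E → ℝ} {b v : E} {C R ν : ℝ} (hR : 0 < R)
    (hν : 0 ≤ ν)
    (hg : ∀ x, R < ‖x‖ → ContDiffAt ℝ 2 g x)
    (hexp : ∀ x, R < ‖x‖ → |g x - inner ℝ b x * ‖x‖ ^ (-ν)| ≤ C * ‖x‖ ^ (-ν))
    (hv : ‖v‖ ≤ 1)
    (hsec : ∀ x, R < ‖x‖ → |fderiv ℝ (fun z => fderiv ℝ g z v) x v| ≤ C * ‖x‖ ^ (-(ν + 1)))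
    (hC : 0 < C) {x : E} (hx : x ≠ 0) :
    Tendsto (fun r : ℝ => r ^ ν * fderiv ℝ g (r • x) v) atTop
      (𝓝 (‖x‖ ^ (-ν) * (inner ℝ b v - ν * inner ℝ b x * inner ℝ x v / ‖x‖ ^ 2))) := by
  set m := ‖x‖ / 2 with hm
  have hx0 : 0 < ‖x‖ := norm_pos_iff.2 hx
  have hm0 : 0 < m := by positivity
  set L : ℝ → ℝ := fun t => inner ℝ b (x + t • v) * ‖x + t • v‖ ^ (-ν) with hL
  have hslope := (hasDerivAt_dipole b v hx ν).tendsto_slope_zero_right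
  set D := ‖x‖ ^ (-ν) * (inner ℝ b v - ν * inner ℝ b x * inner ℝ x v / ‖x‖ ^ 2)
  have hseg : ∀ t ∈ Set.Icc 0 m, m ≤ ‖x + t • v‖ := by
    intro t ht
    have h1 : ‖t • v‖ ≤ m := by
      rw [norm_smul, Real.norm_of_nonneg ht.1]
      calc t * ‖v‖ ≤ m * 1 := by gcongr; exact ht.2
        _ = m := mul_one m
    have h2 := norm_sub_norm_le x (-(t • v))
    rw [norm_neg, sub_neg_eq_add] at h2
    linarith
  have key : ∀ τ ∈ Set.Ioc 0 m, ∀ r > R / m,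
      |τ⁻¹ * (L τ - L 0) - r ^ ν * fderiv ℝ g (r • x) v| ≤
        C * m ^ (-(ν + 1)) * τ + 2 * C * m ^ (-ν) / (r * τ) := by
    intro τ hτ r hr
    have hτ0 : 0 < τ := hτ.1
    have hr0 : 0 < r := lt_trans (by positivity) hr
    have hrm : R < r * m := (div_lt_iff₀ hm0).1 hr
    have hnorm : ∀ t ∈ Set.Icc 0 m, r * m ≤ ‖r • (x + t • v)‖ := by
      intro t ht
      rw [norm_smul, Real.norm_of_nonneg hr0.le]
      exact mul_le_mul_of_nonneg_left (hseg t ht) hr0.le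
    have hval : ∀ t ∈ Set.Icc 0 m,
        |r ^ ν * g (r • (x + t • v)) - r * L t| ≤ C * m ^ (-ν) := by
      intro t ht
      have h1 := hexp _ (hrm.trans_le (hnorm t ht))
      rw [norm_smul, Real.norm_of_nonneg hr0.le, Real.mul_rpow hr0.le (norm_nonneg _),
        real_inner_smul_right, Real.rpow_neg hr0.le] at h1
      have hrν : 0 < r ^ ν := by positivity
      have e : r ^ ν * g (r • (x + t • v)) - r * L t = r ^ ν * (g (r • (x + t • v)) -
          r * inner ℝ b (x + t • v) * ((r ^ ν)⁻¹ * ‖x + t • v‖ ^ (-ν))) := by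
        simp only [hL]
        field_simp
      rw [e, abs_mul, abs_of_pos hrν]
      calc _ ≤ r ^ ν * (C * ((r ^ ν)⁻¹ * ‖x + t • v‖ ^ (-ν))) := by gcongr
        _ = C * ‖x + t • v‖ ^ (-ν) := by field_simp
        _ ≤ C * m ^ (-ν) := mul_le_mul_of_nonneg_left
            (Real.rpow_le_rpow_of_nonpos hm0 (hseg t ht) (by linarith)) hC.le
    have hpt : ∀ s : ℝ, r • x + s • v = r • (x + (s / r) • v) := fun s => by
      rw [smul_add, smul_smul, mul_div_cancel₀ _ hr0.ne']
    have hmem : ∀ s ∈ Set.Icc 0 (r * τ), s / r ∈ Set.Icc 0 m := fun s hs =>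
      ⟨div_nonneg hs.1 hr0.le, (div_le_iff₀ hr0).2 (hs.2.trans (by nlinarith [hτ.2]))⟩
    have hT := abs_sub_sub_fderiv_le (g := g) (x := r • x) (v := v) (h := r * τ)
      (M := C * (r * m) ^ (-(ν + 1))) (by positivity)
      (fun s hs => by
        rw [hpt]
        exact hg _ (hrm.trans_le (hnorm _ (hmem s hs))))
      (fun s hs => by
        rw [hpt]
        refine (hsec _ (hrm.trans_le (hnorm _ (hmem s hs)))).trans ?_
        exact mul_le_mul_of_nonneg_left (Real.rpow_le_rpow_of_nonpos (by positivity)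
          (hnorm _ (hmem s hs)) (by linarith)) hC.le)
    rw [hpt, mul_div_cancel_left₀ _ hr0.ne'] at hT
    have hv0 := hval 0 ⟨le_rfl, hm0.le⟩
    have hvτ := hval τ ⟨hτ0.le, hτ.2⟩
    rw [zero_smul, add_zero] at hv0
    have hT' : |r ^ ν * g (r • (x + τ • v)) - r ^ ν * g (r • x) -
        r * τ * (r ^ ν * fderiv ℝ g (r • x) v)| ≤ C * m ^ (-(ν + 1)) * (r * τ ^ 2) := by
      have hrν : 0 < r ^ ν := by positivity
      have e : r ^ ν * g (r • (x + τ • v)) - r ^ ν * g (r • x) -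
        r * τ * (r ^ ν * fderiv ℝ g (r • x) v) = r ^ ν * (g (r • (x + τ • v)) - g (r • x) -
          r * τ * fderiv ℝ g (r • x) v) := by ring
      rw [e, abs_mul, abs_of_pos hrν]
      calc _ ≤ r ^ ν * (C * (r * m) ^ (-(ν + 1)) * (r * τ) ^ 2) := by gcongr
        _ = _ := by
          rw [Real.mul_rpow hr0.le hm0.le, Real.rpow_neg hr0.le, Real.rpow_add hr0,
            Real.rpow_one]
          field_simp
    have hsum : |r * (L τ - L 0) - r * τ * (r ^ ν * fderiv ℝ g (r • x) v)| ≤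
        C * m ^ (-(ν + 1)) * (r * τ ^ 2) + 2 * (C * m ^ (-ν)) := by
      rw [abs_le] at hT' hv0 hvτ ⊢
      constructor <;> linarith [hT'.1, hT'.2, hv0.1, hv0.2, hvτ.1, hvτ.2]
    have e : τ⁻¹ * (L τ - L 0) - r ^ ν * fderiv ℝ g (r • x) v =
        (r * (L τ - L 0) - r * τ * (r ^ ν * fderiv ℝ g (r • x) v)) / (r * τ) := by
      field_simp
    rw [e, abs_div, abs_of_pos (by positivity : 0 < r * τ), div_le_iff₀ (by positivity)]
    refine hsum.trans (le_of_eq ?_)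
    field_simp
  rw [Metric.tendsto_atTop]
  intro ε hε
  have hK : Tendsto (fun τ : ℝ => C * m ^ (-(ν + 1)) * τ) (𝓝[>] 0) (𝓝 0) := by
    have : Continuous fun τ : ℝ => C * m ^ (-(ν + 1)) * τ := by fun_prop
    simpa using (this.tendsto 0).mono_left (nhdsWithin_le_nhds (s := Set.Ioi 0))
  have hev := ((Metric.tendsto_nhds.1 hslope (ε / 3) (by positivity)).and
    (hK.eventually_lt_const (by positivity : 0 < ε / 3))).and
    (Ioc_mem_nhdsGT hm0)
  obtain ⟨τ, ⟨hτ1, hτ2⟩, hτ3⟩ := hev.exists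
  have hτ0 : 0 < τ := hτ3.1
  refine ⟨max (R / m + 1) (6 * C * m ^ (-ν) / (ε * τ) + 1), fun r hr => ?_⟩
  have hr1 : R / m < r := by linarith [(le_max_left _ _).trans hr]
  have hr2 : 6 * C * m ^ (-ν) / (ε * τ) < r := by linarith [(le_max_right _ _).trans hr]
  have hr0 : 0 < r := lt_trans (by positivity) hr1
  have h1 := key τ hτ3 r hr1
  have h2 : 2 * C * m ^ (-ν) / (r * τ) < ε / 3 := by
    rw [div_lt_iff₀ (by positivity)] at hr2 ⊢
    linarith
  rw [zero_add, smul_eq_mul, Real.dist_eq] at hτ1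
  rw [Real.dist_eq]
  rw [abs_lt] at hτ1 ⊢
  rw [abs_le] at h1
  simp only [hL] at h1
  constructor <;> linarith [h1.1, h1.2, hτ1.1, hτ1.2]

/-- A matrix whose dipole field is closed is a multiple of the identity. -/
lemma eq_single_of_closed_dipole {n : ℕ} (hn : 3 ≤ n) (b : Fin n → EuclideanSpace ℝ (Fin n))
    (hb : ∀ x : EuclideanSpace ℝ (Fin n), x ≠ 0 → ∀ i k : Fin n,
      b i k - n * inner ℝ (b i) x * x k / ‖x‖ ^ 2 =
        b k i - n * inner ℝ (b k) x * x i / ‖x‖ ^ 2) :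
    ∃ B : ℝ, ∀ i, b i = EuclideanSpace.single i B := by
  have hn' : (3 : ℝ) ≤ n := by exact_mod_cast hn
  have hoff' : ∀ i k : Fin n, i ≠ k → b i k - n * b i k = b k i := by
    intro i k hik
    have := hb (EuclideanSpace.single k 1) (by simp) i k
    simpa [EuclideanSpace.inner_single_right, hik] using this
  have hoff : ∀ i k : Fin n, i ≠ k → b i k = 0 := by
    intro i k hik
    have h1 := hoff' i k hik
    have h2 := hoff' k i hik.symm
    have h3 : (n : ℝ) * (n - 2) * b i k = 0 := by
      rw [← h1] at h2
      linear_combination h2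
    have : (n : ℝ) * (n - 2) ≠ 0 := by
      have : 0 < (n : ℝ) - 2 := by linarith
      positivity
    exact (mul_eq_zero.1 h3).resolve_left this
  have hdiag : ∀ i k : Fin n, b i i = b k k := by
    intro i k
    by_cases hik : i = k
    · rw [hik]
    have hnorm : ‖(EuclideanSpace.single i (1 : ℝ) + EuclideanSpace.single k 1 :
        EuclideanSpace ℝ (Fin n))‖ ^ 2 = 2 := by
      rw [norm_add_sq_real]
      simp [EuclideanSpace.inner_single_right, Ne.symm hik]
      norm_num
    have := hb (EuclideanSpace.single i 1 + EuclideanSpace.single k 1)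
      (fun h0 => by simp [h0] at hnorm) i k
    rw [hnorm] at this
    simp [inner_add_right, EuclideanSpace.inner_single_right, hik, Ne.symm hik,
      hoff i k hik, hoff k i (Ne.symm hik)] at this
    exact this.resolve_right (by omega)
  refine ⟨b ⟨0, by omega⟩ ⟨0, by omega⟩, fun i => ?_⟩
  ext k
  by_cases hik : i = k
  · subst hik
    simpa using hdiag i _
  · simp [hoff i k hik, Ne.symm hik]

lemma BigOInfty.apply {n : ℕ} {ω : EuclideanSpace ℝ (Fin n) → EuclideanSpace ℝ (Fin n)}
    {R α : ℝ} (hω : ContDiffOn ℝ (⊤ : ℕ∞) ω {x | R < ‖x‖}) (hO : BigOInfty ω R α) (i : Fin n) :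
    BigOInfty (fun x => ω x i) R α := by
  intro j
  obtain ⟨C, hC, R₀, hR₀, h⟩ := hO j
  refine ⟨(‖(EuclideanSpace.proj i : EuclideanSpace ℝ (Fin n) →L[ℝ] ℝ)‖ + 1) * C, by positivity,
    max R₀ (R + 1), le_max_of_le_left hR₀, fun x hx => ?_⟩
  have hx1 := (le_max_left _ _).trans hx
  have hx2 : R < ‖x‖ := by linarith [(le_max_right _ _).trans hx]
  have hcd : ContDiffAt ℝ (⊤ : ℕ∞) ω x :=
    hω.contDiffAt ((isOpen_setOf_lt_norm R).mem_nhds hx2)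
  refine (ContinuousLinearMap.norm_iteratedFDeriv_comp_left
    (EuclideanSpace.proj i : EuclideanSpace ℝ (Fin n) →L[ℝ] ℝ) hcd (n := j)
    (by exact_mod_cast le_top)).trans ?_
  rw [mul_assoc]
  gcongr
  · linarith
  · exact h x hx1

/-- Let `n ≥ 3`, `R > 0`, `ε > 0`, and let `ω : {x ∈ ℝⁿ : |x| > R} → ℝⁿ` be a smooth
vector field with each component harmonic, `ω = 𝒪_∞(r^{1−n})`, whose associated 1-form is
closed (`∂ωⱼ/∂xᵢ = ∂ωᵢ/∂xⱼ`), and with `div ω = 𝒪_∞(r^{−n−ε})`. Then there is `B ∈ ℝ`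
with `ω(x) = B |x|^{−n} x + O(|x|^{−n})` as `|x| → ∞`. -/
theorem closed_harmonic_vector_field_asymptotics (n : ℕ) (hn : 3 ≤ n)
    (R : ℝ) (hR : 0 < R) (ε : ℝ) (hε : 0 < ε)
    (ω : EuclideanSpace ℝ (Fin n) → EuclideanSpace ℝ (Fin n))
    (hharm : ∀ i : Fin n, IsHarmonicOn (fun x => ω x i) {x | R < ‖x‖})
    (hO : BigOInfty ω R (1 - (n : ℝ)))
    (hclosed : ∀ x : EuclideanSpace ℝ (Fin n), R < ‖x‖ → ∀ i j : Fin n,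
      fderiv ℝ (fun y => ω y j) x (EuclideanSpace.single i 1) =
      fderiv ℝ (fun y => ω y i) x (EuclideanSpace.single j 1))
    (hdiv : BigOInfty (divergence ω) R (-(n : ℝ) - ε)) :
    ∃ B : ℝ, ∃ C > 0, ∃ R₀ > 0, ∀ x : EuclideanSpace ℝ (Fin n), R₀ ≤ ‖x‖ →
      ‖ω x - (B * ‖x‖ ^ (-(n : ℝ))) • x‖ ≤ C * ‖x‖ ^ (-(n : ℝ)) := by
  have hn' : (3 : ℝ) ≤ n := by exact_mod_cast hn
  have hsmooth : ContDiffOn ℝ (⊤ : ℕ∞) ω {x | R < ‖x‖} :=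
    contDiffOn_euclidean.2 fun i => (hharm i).1
  have hOi := fun i => hO.apply hsmooth i
  choose b C hC R₁ hR₁ hexp using fun i => (hharm i).exists_dipole_expansion hn hR (hOi i)
  choose D hD R₂ hR₂ hder using fun i =>
    BigOInfty.exists_partialDeriv_bounds (a := (n : ℝ) - 1) (hharm i).1
      (by rw [neg_sub]; exact hOi i)
  have hlim : ∀ (i k : Fin n) (x : EuclideanSpace ℝ (Fin n)), x ≠ 0 →
      Tendsto (fun r : ℝ => r ^ (n : ℝ) *
        fderiv ℝ (fun y => ω y i) (r • x) (EuclideanSpace.single k 1)) atTop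
        (𝓝 (‖x‖ ^ (-(n : ℝ)) * (b i k - n * inner ℝ (b i) x * x k / ‖x‖ ^ 2))) := by
    intro i k x hx
    have hCD : C i ≤ max (C i) (D i) ∧ D i ≤ max (C i) (D i) :=
      ⟨le_max_left _ _, le_max_right _ _⟩
    have hmax : ∀ y : EuclideanSpace ℝ (Fin n), max R (max (R₁ i) (R₂ i)) < ‖y‖ →
        R < ‖y‖ ∧ R₁ i < ‖y‖ ∧ R₂ i < ‖y‖ := fun y hy => by
      simpa only [max_lt_iff] using hy
    have := tendsto_rpow_mul_fderiv_of_dipole (g := fun y => ω y i) (b := b i)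
      (v := EuclideanSpace.single k 1) (C := max (C i) (D i))
      (R := max R (max (R₁ i) (R₂ i))) (ν := n) (by positivity) (by positivity)
      (fun y hy => ((hharm i).1.contDiffAt ((isOpen_setOf_lt_norm R).mem_nhds
        (hmax y hy).1)).of_le (m := 2) (WithTop.coe_le_coe.2 le_top))
      (fun y hy => (hexp i y (hmax y hy).2.1.le).trans (by gcongr; exact hCD.1))
      (by simp)
      (fun y hy => by
        refine ((hder i y (hmax y hy).2.2.le).2 k).2.trans ?_
        rw [show (n : ℝ) - 1 + 2 = n + 1 by ring]
        gcongr
        exact hCD.2)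
      (lt_of_lt_of_le (hC i) hCD.1) hx
    simpa [EuclideanSpace.inner_single_right] using this
  obtain ⟨B, hB⟩ := eq_single_of_closed_dipole hn b fun x hx i k => by
    have h1 := hlim i k x hx
    have h2 := hlim k i x hx
    have hx0 : 0 < ‖x‖ := norm_pos_iff.2 hx
    have h3 := tendsto_nhds_unique (h1.congr' ?_) h2
    · exact mul_left_cancel₀ (by positivity) h3
    · filter_upwards [eventually_gt_atTop (R / ‖x‖)] with r hr
      have hr0 : 0 < r := lt_trans (by positivity) hr
      rw [hclosed (r • x) (by
        rw [norm_smul, Real.norm_of_nonneg hr0.le]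
        exact (div_lt_iff₀ hx0).1 hr) k i]
  have hRs : ∀ i, R₁ i ≤ ∑ j, R₁ j := fun i =>
    Finset.single_le_sum (fun j _ => (hR₁ j).le) (Finset.mem_univ i)
  refine ⟨B, ∑ i, C i + 1, ?_, ∑ i, R₁ i + 1, ?_, fun x hx => ?_⟩
  · have : 0 ≤ ∑ i, C i := Finset.sum_nonneg fun i _ => (hC i).le
    positivity
  · have : 0 ≤ ∑ i, R₁ i := Finset.sum_nonneg fun i _ => (hR₁ i).le
    positivity
  have hcomp : ∀ i, ‖(ω x - (B * ‖x‖ ^ (-(n : ℝ))) • x) i‖ ≤ C i * ‖x‖ ^ (-(n : ℝ)) := by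
    intro i
    have := hexp i x (by linarith [hRs i])
    rw [hB i, EuclideanSpace.inner_single_left] at this
    rw [Real.norm_eq_abs]
    convert this using 2
    simp
    ring
  have hnorm : ∀ y : EuclideanSpace ℝ (Fin n), ‖y‖ ≤ ∑ i, ‖y i‖ := by
    intro y
    conv_lhs => rw [← (EuclideanSpace.basisFun (Fin n) ℝ).sum_repr y]
    refine (norm_sum_le _ _).trans (Finset.sum_le_sum fun i _ => ?_)
    simp [norm_smul]
  calc _ ≤ ∑ i, C i * ‖x‖ ^ (-(n : ℝ)) :=
        (hnorm _).trans (Finset.sum_le_sum fun i _ => hcomp i)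
    _ = (∑ i, C i) * ‖x‖ ^ (-(n : ℝ)) := by rw [Finset.sum_mul]
    _ ≤ _ := by gcongr; linarith
end
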